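/- arXiv:2206.03444 — 3 statements merged into one kernel-verified Lean document; each statement's English description precedes it below -/
import Mathlib

section
/- Let 1 ≤ D < E ≤ L, let τ := η(D,E), let W ∈ 𝔾_{L,w} and let v ∈ ℂ^L be a unit vector with Wv = 0. Then the two symmetric inequalities hold: ‖𝔵(((ℛ·W)^⊥ℛ)∘v)‖² ≤ ‖𝔵(v)‖²·[1 − τ·‖𝔷(v)‖²] + 2·tr[(ζ̂^⊥)*Wζ̂^⊥], and ‖𝔷(((ℛ·W)^⊥ℛ)∘v)‖² ≥ ‖𝔷(v)‖²·[1 + τ·‖𝔵(v)‖²] − 2·tr[(ζ̂^⊥)*Wζ̂^⊥]. -/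
open Matrix BigOperators

noncomputable section

/-- The squared Euclidean norm of a complex vector. -/
def sqNorm {n : ℕ} (v : Fin n → ℂ) : ℝ := ∑ i, ‖v i‖ ^ 2

/-- The Euclidean norm of a complex vector. -/
def vNorm {n : ℕ} (v : Fin n → ℂ) : ℝ := Real.sqrt (sqNorm v)

/-- Membership in the Grassmannian `𝔾_{L,q}`: an orthogonal projection of rank `q`. -/
def IsProjOfRank {L : ℕ} (q : ℕ) (Q : Matrix (Fin L) (Fin L) ℂ) : Prop :=
  Q * Q = Q ∧ Qᴴ = Q ∧ Q.trace = (q : ℂ)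

/-- The action `T · Q` of an invertible matrix `T` on the Grassmannian: for `Q = ΦΦ*` this
equals `TΦ(Φ*T*TΦ)⁻¹Φ*T*`, i.e. the orthogonal projection onto `T (ran Q)`. -/
def grAct {L : ℕ} (T Q : Matrix (Fin L) (Fin L) ℂ) : Matrix (Fin L) (Fin L) ℂ :=
  T * Q * (Q * Tᴴ * T * Q + (1 - Q))⁻¹ * (Q * Tᴴ)

/-- The normalized image `S ∘ v := Sv / ‖Sv‖`. -/
def circAct {n : ℕ} (S : Matrix (Fin n) (Fin n) ℂ) (v : Fin n → ℂ) : Fin n → ℂ :=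
  ((vNorm (S.mulVec v) : ℂ))⁻¹ • S.mulVec v

/-- Relative gap `η(I,J) = 1 - κ_J²/κ_I²` (1-based indices). -/
def eta (κ : ℕ → ℝ) (i j : ℕ) : ℝ := 1 - κ j ^ 2 / κ i ^ 2

/-- The diagonal matrix `ℛ = diag(κ_L, …, κ_1)` (top-to-bottom entries `κ_L, …, κ_1`). -/
def Rmat (κ : ℕ → ℝ) (L : ℕ) : Matrix (Fin L) (Fin L) ℂ :=
  Matrix.diagonal fun i : Fin L => (κ (L - (i : ℕ)) : ℂ)

/-- The frame consisting of the standard basis vectors `e_{s+1}, …, e_{s+r}`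
(rows `s, …, s+r-1`). -/
def basisFrame (L r s : ℕ) : Matrix (Fin L) (Fin r) ℂ :=
  Matrix.of fun i j => if (i : ℕ) = s + (j : ℕ) then 1 else 0

/-- `‖𝔵(v)‖²`: squared norm of the top `L - E` entries of `v`. -/
def xSq (E : ℕ) {L : ℕ} (v : Fin L → ℂ) : ℝ :=
  ∑ i : Fin L, if (i : ℕ) < L - E then ‖v i‖ ^ 2 else 0

/-- `‖𝔷(v)‖²`: squared norm of the bottom `D` entries of `v`. -/
def zSq (D : ℕ) {L : ℕ} (v : Fin L → ℂ) : ℝ :=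
  ∑ i : Fin L, if L - D ≤ (i : ℕ) then ‖v i‖ ^ 2 else 0

section Aux
set_option linter.unusedSectionVars false
open scoped ComplexOrder

variable {n : Type*} [Fintype n] [DecidableEq n]

/-- real diagonal matrix -/
abbrev rdiag (d : n → ℝ) : Matrix n n ℂ := Matrix.diagonal fun i => (d i : ℂ)

theorem rdiag_mul (d e : n → ℝ) : rdiag d * rdiag e = rdiag (fun i => d i * e i) := by
  simp [rdiag]

theorem rdiag_psd (d : n → ℝ) (h : ∀ i, 0 ≤ d i) : (rdiag d).PosSemidef := by
  apply Matrix.PosSemidef.diagonal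
  intro i
  simpa using h i

theorem rdiag_herm (d : n → ℝ) : (rdiag d)ᴴ = rdiag d := by
  rw [rdiag, Matrix.diagonal_conjTranspose]
  congr 1
  funext i
  simp

theorem sandwich_psd {V S : Matrix n n ℂ} (hh : Vᴴ = V) (hS : S.PosSemidef) :
    (V * S * V).PosSemidef := by
  have := hS.conjTranspose_mul_mul_same V
  rwa [hh] at this

theorem compl_herm {V : Matrix n n ℂ} (hh : Vᴴ = V) : (1 - V)ᴴ = 1 - V := by
  simp [hh]

theorem compl_idem {V : Matrix n n ℂ} (hi : V * V = V) : (1 - V) * (1 - V) = 1 - V := by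
  simp [mul_sub, sub_mul, hi]

theorem proj_psd {V : Matrix n n ℂ} (hi : V * V = V) (hh : Vᴴ = V) : V.PosSemidef := by
  have := Matrix.posSemidef_conjTranspose_mul_self V
  rwa [hh, hi] at this

theorem trace_sandwich (V S : Matrix n n ℂ) (d : n → ℝ) :
    (S * (V * rdiag d * V)).trace = ∑ i, (V * S * V) i i * d i := by
  have : (S * (V * rdiag d * V)).trace = (V * S * V * rdiag d).trace := by
    rw [← mul_assoc, Matrix.trace_mul_comm]
    simp only [mul_assoc]
  rw [this]
  simp [Matrix.trace, rdiag, Matrix.mul_diagonal]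

theorem trace_sandwich_nonneg {V S : Matrix n n ℂ} (hh : Vᴴ = V) (hS : S.PosSemidef)
    (d : n → ℝ) (hd : ∀ i, 0 ≤ d i) : 0 ≤ (S * (V * rdiag d * V)).trace.re := by
  rw [trace_sandwich, Complex.re_sum]
  refine Finset.sum_nonneg fun i _ => ?_
  have h1 := (sandwich_psd hh hS).diag_nonneg (i := i)
  have h2 : 0 ≤ ((V * S * V) i i).re := (Complex.le_def.1 h1).1
  simpa using mul_nonneg h2 (hd i)

theorem trace_compl_nonneg {V S : Matrix n n ℂ} (hi : V * V = V) (hh : Vᴴ = V)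
    (hS : S.PosSemidef) : 0 ≤ (S * (1 - V)).trace.re := by
  have h := trace_sandwich_nonneg (compl_herm hh) hS (fun _ => 1) (fun _ => zero_le_one)
  have e : (rdiag (fun _ : n => (1:ℝ))) = 1 := by simp [rdiag]
  rwa [e, mul_one, compl_idem hi] at h

theorem gram_posDef {V : Matrix n n ℂ} (hi : V * V = V) (hh : Vᴴ = V)
    (d : n → ℝ) (hd : ∀ i, 0 < d i) : (V * rdiag d * V + (1 - V)).PosDef := by
  have p1 : (rdiag d).PosDef := by
    apply Matrix.PosDef.diagonal
    intro i; simpa using hd i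
  have p2 := sandwich_psd hh p1.posSemidef
  have p3 : (1 - V).PosSemidef := proj_psd (compl_idem hi) (compl_herm hh)
  refine Matrix.PosDef.of_dotProduct_mulVec_pos (p2.add p3).1 ?_
  intro x hx
  rw [Matrix.add_mulVec, dotProduct_add]
  by_cases hV : V *ᵥ x = 0
  · have e1 : (V * rdiag d * V) *ᵥ x = 0 := by
      rw [← Matrix.mulVec_mulVec, hV, Matrix.mulVec_zero]
    have e2 : (1 - V) *ᵥ x = x := by rw [Matrix.sub_mulVec, hV]; simp
    rw [e1, e2, dotProduct_zero, zero_add]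
    exact dotProduct_star_self_pos_iff.2 hx
  · refine add_pos_of_pos_of_nonneg ?_ (p3.dotProduct_mulVec_nonneg x)
    have := p1.dotProduct_mulVec_pos hV
    rw [Matrix.star_mulVec, hh, ← Matrix.dotProduct_mulVec, Matrix.mulVec_mulVec,
      Matrix.mulVec_mulVec] at this
    simpa [mul_assoc] using this

/-- inverse lower bound -/
theorem inv_lower {G K : Matrix n n ℂ} (hG : G.PosDef) (hK : Kᴴ = K) :
    (G⁻¹ - (2 • K - K * G * K)).PosSemidef := by
  have hdet : IsUnit G.det := (Matrix.isUnit_iff_isUnit_det _).1 hG.isUnit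
  have h1 : (G⁻¹ - K)ᴴ = G⁻¹ - K := by
    rw [Matrix.conjTranspose_sub, Matrix.conjTranspose_nonsing_inv, hG.1, hK]
  have := sandwich_psd h1 hG.posSemidef
  have e : (G⁻¹ - K) * G * (G⁻¹ - K) = G⁻¹ - (2 • K - K * G * K) := by
    rw [sub_mul, Matrix.nonsing_inv_mul _ hdet, sub_mul, mul_sub, mul_sub, one_mul, one_mul,
      mul_assoc K G G⁻¹, Matrix.mul_nonsing_inv _ hdet, mul_one]
    abel
  rwa [e] at this

theorem inv_anti {G G' : Matrix n n ℂ} (hG : G.PosDef) (hG' : G'.PosDef)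
    (hle : (G' - G).PosSemidef) : (G⁻¹ - G'⁻¹).PosSemidef := by
  have hdet : IsUnit G'.det := (Matrix.isUnit_iff_isUnit_det _).1 hG'.isUnit
  have h1 : (G'⁻¹)ᴴ = G'⁻¹ := by
    rw [Matrix.conjTranspose_nonsing_inv, hG'.1]
  have := (inv_lower hG h1).add (sandwich_psd h1 hle)
  convert this using 1
  rw [mul_sub, sub_mul, Matrix.nonsing_inv_mul _ hdet, one_mul]
  abel

theorem gram_facts {V : Matrix n n ℂ} (hi : V * V = V) (hh : Vᴴ = V)
    (r : n → ℝ) (hr : ∀ i, 0 < r i) (G P' : Matrix n n ℂ)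
    (hG : G = V * rdiag (fun i => r i * r i) * V + (1 - V))
    (hP' : P' = rdiag r * V * G⁻¹ * (V * rdiag r)) :
    G.PosDef ∧ P'ᴴ = P' ∧ P' * (rdiag r * V) = rdiag r * V ∧
      (G⁻¹ * (1 - V) = 1 - V) := by
  have pd : G.PosDef := hG ▸ gram_posDef hi hh _ (fun i => mul_pos (hr i) (hr i))
  have hdet : IsUnit G.det := (Matrix.isUnit_iff_isUnit_det _).1 pd.isUnit
  have hGi : (G⁻¹)ᴴ = G⁻¹ := by
    rw [Matrix.conjTranspose_nonsing_inv, pd.1]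
  have g1 : G * V = V * rdiag (fun i => r i * r i) * V := by
    rw [hG, add_mul, sub_mul, one_mul, hi, sub_self, add_zero, mul_assoc, hi]
  have g2 : G * (1 - V) = 1 - V := by
    rw [hG, add_mul, compl_idem hi, mul_assoc, mul_sub, hi]; simp
  refine ⟨pd, ?_, ?_, ?_⟩
  · rw [hP']
    simp only [Matrix.conjTranspose_mul, hGi, hh, rdiag_herm, mul_assoc]
  · have : P' * (rdiag r * V) = rdiag r * V * G⁻¹ * (V * (rdiag r * rdiag r) * V) := by
      rw [hP']; simp only [mul_assoc]
    rw [this, rdiag_mul, ← g1, ← mul_assoc, Matrix.nonsing_inv_mul_cancel_right _ _ hdet,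
      mul_assoc, hi]
  · conv_lhs => rw [← g2]
    rw [Matrix.nonsing_inv_mul_cancel_left _ _ hdet]

theorem keyZ {V P S : Matrix n n ℂ} (hi : V * V = V) (hh : Vᴴ = V) (hP : Pᴴ = P)
    (r z x : n → ℝ) (τ : ℝ) (hτ : 0 ≤ τ) (hr : ∀ i, 0 < r i)
    (hz : ∀ i, z i = 0 ∨ z i = 1) (hx : ∀ i, 0 ≤ x i)
    (h1 : ∀ i, z i ≤ z i * (r i * r i))
    (h2 : ∀ i, (1 - z i) * (r i * r i) ≤ 1 - z i - τ * x i)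
    (hfix : P * (rdiag r * V) = rdiag r * V) (hS : P = rdiag r * V * S) :
    (rdiag z * V).trace.re + τ * (V * rdiag x * V * (V * rdiag z * V)).trace.re
      ≤ (rdiag z * P).trace.re := by
  have hz0 : ∀ i, 0 ≤ z i := fun i => by rcases hz i with h | h <;> simp [h]
  have hz1 : ∀ i, 0 ≤ 1 - z i := fun i => by rcases hz i with h | h <;> simp [h]
  obtain ⟨G, hG⟩ : ∃ G, G = V * rdiag (fun i => r i * r i) * V + (1 - V) := ⟨_, rfl⟩
  obtain ⟨P', hP'⟩ : ∃ P', P' = rdiag r * V * G⁻¹ * (V * rdiag r) := ⟨_, rfl⟩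
  obtain ⟨pd, ph, pf, -⟩ := gram_facts hi hh r hr G P' hG hP'
  have hdet : IsUnit G.det := (Matrix.isUnit_iff_isUnit_det _).1 pd.isUnit
  have e1 : P' * P = P := by rw [hS, ← mul_assoc, pf]
  have e2 : P * P' = P' := by rw [hP', mul_assoc (rdiag r * V), ← mul_assoc P, hfix]
  have e3 : P = P' := by
    have := congrArg Matrix.conjTranspose e1
    rw [Matrix.conjTranspose_mul, hP, ph, e2] at this
    exact this.symm
  -- trace in terms of G
  obtain ⟨GZ, hGZ⟩ : ∃ M, M = V * rdiag (fun i => z i * (r i * r i)) * V := ⟨_, rfl⟩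
  obtain ⟨H, hH⟩ : ∃ M, M = V * rdiag (fun i => (1 - z i) * (r i * r i)) * V + (1 - V) := ⟨_, rfl⟩
  obtain ⟨A, hA⟩ : ∃ M, M = V * rdiag z * V := ⟨_, rfl⟩
  obtain ⟨B, hB⟩ : ∃ M, M = V * rdiag x * V := ⟨_, rfl⟩
  have t1 : (rdiag z * P).trace = (G⁻¹ * GZ).trace := by
    have : rdiag r * rdiag z * rdiag r = rdiag (fun i => z i * (r i * r i)) := by
      rw [rdiag_mul, rdiag_mul]; congr 1; funext i; ring
    rw [e3, hP', hGZ, ← this, ← mul_assoc, Matrix.trace_mul_comm, ← mul_assoc, ← mul_assoc,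
      ← mul_assoc, Matrix.trace_mul_comm]
    simp only [mul_assoc]
  have addd : ∀ a b : n → ℝ, V * rdiag a * V + V * rdiag b * V
      = V * rdiag (fun i => a i + b i) * V := by
    intro a b
    rw [← add_mul, ← mul_add]; simp [rdiag, Matrix.diagonal_add]
  have subd : ∀ a b : n → ℝ, V * rdiag a * V - V * rdiag b * V
      = V * rdiag (fun i => a i - b i) * V := by
    intro a b
    rw [← sub_mul, ← mul_sub]; simp [rdiag, Matrix.diagonal_sub]
  have smd : ∀ (c : ℝ) (b : n → ℝ), (c : ℂ) • (V * rdiag b * V)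
      = V * rdiag (fun i => c * b i) * V := by
    intro c b
    rw [← Matrix.smul_mul, ← Matrix.mul_smul]; congr 2
    rw [← Matrix.diagonal_smul]; congr 1; funext i; simp
  have oned : V * rdiag (fun _ => (1:ℝ)) * V = V := by simp [rdiag, hi]
  have hGsum : G = GZ + H := by
    rw [hG, hGZ, hH, ← add_assoc, addd]; congr 4; funext i; ring
  have hG1 : (A + H).PosDef := by
    rw [hA, hH, ← add_assoc, addd]
    apply gram_posDef hi hh
    intro i
    rcases hz i with h | h <;> simp [h]
    exact (hr i).ne'
  have hdet1 : IsUnit (A + H).det := (Matrix.isUnit_iff_isUnit_det _).1 hG1.isUnit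
  have le1 : (G - (A + H)).PosSemidef := by
    rw [hGsum, add_sub_add_right_eq_sub, hGZ, hA, subd]
    exact sandwich_psd hh (rdiag_psd _ fun i => sub_nonneg.2 (h1 i))
  have anti := inv_anti hG1 pd le1
  have t2 : 0 ≤ (((A + H)⁻¹ - G⁻¹) * H).trace.re := by
    nth_rewrite 2 [hH]
    rw [mul_add, Matrix.trace_add, Complex.add_re]
    exact add_nonneg (trace_sandwich_nonneg hh anti _
      fun i => mul_nonneg (hz1 i) (mul_self_nonneg _)) (trace_compl_nonneg hi hh anti)
  have t3 : (G⁻¹ * GZ) = 1 - G⁻¹ * H := by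
    rw [eq_sub_iff_add_eq, ← mul_add, ← hGsum, Matrix.nonsing_inv_mul _ hdet]
  have t4 : ((A + H)⁻¹ * A) = 1 - (A + H)⁻¹ * H := by
    rw [eq_sub_iff_add_eq, ← mul_add, Matrix.nonsing_inv_mul _ hdet1]
  have t5 : ((A + H)⁻¹ * A).trace.re ≤ (G⁻¹ * GZ).trace.re := by
    rw [t3, t4]
    rw [sub_mul] at t2
    simp only [Matrix.trace_sub, Complex.sub_re] at t2 ⊢
    linarith
  -- lower bound
  have hBp : B.PosSemidef := hB ▸ sandwich_psd hh (rdiag_psd _ hx)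
  obtain ⟨T, hT⟩ : ∃ T, T = (τ : ℂ) • B := ⟨_, rfl⟩
  have hTp : T.PosSemidef := by
    rw [hT]; exact hBp.smul (by simpa using hτ)
  have hK : (1 + T)ᴴ = 1 + T := by
    rw [Matrix.conjTranspose_add, hTp.1, Matrix.conjTranspose_one]
  have le2 : (1 - T - (A + H)).PosSemidef := by
    have : 1 - T - (A + H)
        = V * rdiag (fun i => 1 - τ * x i - (z i + (1 - z i) * (r i * r i))) * V := by
      rw [← subd, ← subd, ← addd, ← smd, oned, ← hA, ← hB, ← hT, hH]
      abel
    rw [this]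
    exact sandwich_psd hh (rdiag_psd _ fun i => by linarith [h2 i])
  have le3 : ((A + H)⁻¹ - (1 + T)).PosSemidef := by
    have q1 := inv_lower hG1 hK
    have q2 := sandwich_psd hK le2
    have q3 : (T * T).PosSemidef := by
      have := Matrix.posSemidef_conjTranspose_mul_self T
      rwa [hTp.1] at this
    have q4 := sandwich_psd hTp.1 hTp
    convert ((q1.add q2).add q3).add q4 using 1
    noncomm_ring
  have t6 := trace_sandwich_nonneg hh le3 z hz0
  rw [← hA, sub_mul, add_mul, one_mul, hT, Matrix.smul_mul] at t6
  simp only [Matrix.trace_sub, Matrix.trace_add, Matrix.trace_smul, Complex.sub_re,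
    Complex.add_re, smul_eq_mul, Complex.re_ofReal_mul] at t6
  have t7 : (rdiag z * V).trace = A.trace := by
    rw [hA, Matrix.trace_mul_comm (V * _), ← mul_assoc, hi, Matrix.trace_mul_comm]
  rw [t1, t7, ← hA, ← hB]
  linarith

theorem qform {V : Matrix n n ℂ} (hi : V * V = V) (hh : Vᴴ = V) (z x : n → ℝ) :
    (V * rdiag x * V * (V * rdiag z * V)).trace.re
      = ∑ i, ∑ j, z i * (x j * ‖V i j‖ ^ 2) := by
  have e : V * (V * rdiag x * V) * V = V * rdiag x * V := by
    rw [mul_assoc, mul_assoc, hi, ← mul_assoc, ← mul_assoc, hi]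
  rw [trace_sandwich, e, Complex.re_sum]
  refine Finset.sum_congr rfl fun i _ => ?_
  have : (V * rdiag x * V) i i = ((∑ j, x j * ‖V i j‖ ^ 2 : ℝ) : ℂ) := by
    rw [Matrix.mul_apply]
    push_cast
    refine Finset.sum_congr rfl fun j _ => ?_
    have h1 : V j i = star (V i j) := by
      conv_lhs => rw [← hh]
      rfl
    rw [rdiag, Matrix.mul_diagonal, h1, ← Complex.mul_conj']
    simp only [RCLike.star_def]
    ring
  rw [this, ← Complex.ofReal_mul, Complex.ofReal_re, Finset.sum_mul]
  exact Finset.sum_congr rfl fun j _ => by ring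

/-- `P` is the orthogonal projection onto `rdiag r (ran V)`. -/
def RelP (r : n → ℝ) (V P : Matrix n n ℂ) : Prop :=
  Pᴴ = P ∧ P * (rdiag r * V) = rdiag r * V ∧ ∃ S, P = rdiag r * V * S

theorem RelP.scale {r : n → ℝ} {V P : Matrix n n ℂ} (h : RelP r V P) (c : ℝ) (hc : c ≠ 0) :
    RelP (fun i => c * r i) V P := by
  obtain ⟨h1, h2, S, h3⟩ := h
  have e : rdiag (fun i => c * r i) = (c : ℂ) • rdiag r := by
    rw [rdiag, rdiag, ← Matrix.diagonal_smul]; congr 1; funext i; simp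
  refine ⟨h1, ?_, (c : ℂ)⁻¹ • S, ?_⟩
  · rw [e, Matrix.smul_mul, Matrix.mul_smul, h2]
  · have : (c : ℂ) ≠ 0 := by exact_mod_cast hc
    rw [e, Matrix.smul_mul, Matrix.smul_mul, Matrix.mul_smul, smul_smul, mul_inv_cancel₀ this,
      one_smul, ← h3]

theorem RelP.dual {r : n → ℝ} {V P : Matrix n n ℂ} (hi : V * V = V) (hh : Vᴴ = V)
    (h : RelP r V P) (hr : ∀ i, 0 < r i) :
    RelP (fun i => (r i)⁻¹) (1 - V) (1 - P) := by
  obtain ⟨h1, h2, S, h3⟩ := h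
  have e1 : rdiag r * rdiag (fun i => (r i)⁻¹) = 1 := by
    rw [rdiag_mul]
    have : (fun i => r i * (r i)⁻¹) = fun _ => 1 := by
      funext i; exact mul_inv_cancel₀ (hr i).ne'
    rw [this]; simp [rdiag]
  have e2 : rdiag (fun i => (r i)⁻¹) * rdiag r = 1 := mul_eq_one_comm.1 e1
  have h3' : P = Sᴴ * V * rdiag r := by
    have := congrArg Matrix.conjTranspose h3
    rw [h1] at this
    rw [this]
    simp only [Matrix.conjTranspose_mul, hh, rdiag_herm, mul_assoc]
  have h2' : V * rdiag r * P = V * rdiag r := by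
    have := congrArg Matrix.conjTranspose h2
    simpa only [Matrix.conjTranspose_mul, hh, rdiag_herm, h1] using this
  have h0 : P * (rdiag (fun i => (r i)⁻¹) * (1 - V)) = 0 := by
    rw [h3', ← mul_assoc, mul_assoc _ (rdiag r), e1, mul_one, mul_assoc, mul_sub, hi, mul_one,
      sub_self, mul_zero]
  refine ⟨compl_herm h1, ?_, rdiag r * (1 - P), ?_⟩
  · rw [sub_mul, h0, one_mul, sub_zero]
  · have : V * (rdiag r * (1 - P)) = 0 := by
      rw [← mul_assoc, mul_sub, h2', mul_one, sub_self]
    rw [mul_assoc, sub_mul, this, one_mul, sub_zero, ← mul_assoc, e2, one_mul]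

theorem keyX {V P : Matrix n n ℂ} (hi : V * V = V) (hh : Vᴴ = V)
    (r z x : n → ℝ) (τ : ℝ) (hτ : 0 ≤ τ) (hr : ∀ i, 0 < r i)
    (hx : ∀ i, x i = 0 ∨ x i = 1) (hz : ∀ i, 0 ≤ z i) (hxz : ∀ i, z i * x i = 0)
    (h1 : ∀ i, x i ≤ x i * ((r i)⁻¹ * (r i)⁻¹))
    (h2 : ∀ i, (1 - x i) * ((r i)⁻¹ * (r i)⁻¹) ≤ 1 - x i - τ * z i)
    (hrel : RelP r V P) :
    (rdiag x * P).trace.re ≤ (rdiag x * V).trace.re -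
      τ * ∑ i, ∑ j, z i * (x j * ‖V i j‖ ^ 2) := by
  obtain ⟨d1, d2, S, d3⟩ := hrel.dual hi hh hr
  have k := keyZ (compl_idem hi) (compl_herm hh) d1 _ x z τ hτ (fun i => inv_pos.2 (hr i)) hx hz
    h1 h2 d2 d3
  rw [qform (compl_idem hi) (compl_herm hh)] at k
  have e : ∑ i, ∑ j, x i * (z j * ‖(1 - V) i j‖ ^ 2)
      = ∑ i, ∑ j, z i * (x j * ‖V i j‖ ^ 2) := by
    rw [Finset.sum_comm]
    refine Finset.sum_congr rfl fun i _ => Finset.sum_congr rfl fun j _ => ?_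
    by_cases hij : j = i
    · subst hij
      linear_combination (‖(1 - V) j j‖ ^ 2 - ‖V j j‖ ^ 2) * hxz j
    · have e1 : V j i = star (V i j) := by
        conv_lhs => rw [← hh]
        rfl
      rw [Matrix.sub_apply, Matrix.one_apply_ne hij, zero_sub, norm_neg, e1, norm_star]
      ring
  rw [e] at k
  simp only [mul_sub, mul_one, Matrix.trace_sub, Complex.sub_re] at k
  linarith

theorem proj_row {W : Matrix n n ℂ} (hi : W * W = W) (hh : Wᴴ = W) (j : n) :
    ∑ i, ‖W i j‖ ^ 2 = (W j j).re := by
  have : W j j = ((∑ i, ‖W i j‖ ^ 2 : ℝ) : ℂ) := by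
    conv_lhs => rw [← hi, Matrix.mul_apply]
    push_cast
    refine Finset.sum_congr rfl fun i _ => ?_
    have h1 : W j i = star (W i j) := by
      conv_lhs => rw [← hh]
      rfl
    rw [h1, ← Complex.conj_mul']; rfl
  rw [this, Complex.ofReal_re]

theorem herm_norm {W : Matrix n n ℂ} (hh : Wᴴ = W) (i j : n) : ‖W i j‖ = ‖W j i‖ := by
  conv_lhs => rw [← hh]
  rw [Matrix.conjTranspose_apply, norm_star]

theorem proj_entry {W : Matrix n n ℂ} (hi : W * W = W) (hh : Wᴴ = W) (i j : n) :
    ‖W i j‖ ^ 2 ≤ (W i i).re * (W j j).re := by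
  have h1 : ‖W i j‖ ≤ ∑ k, ‖W k i‖ * ‖W k j‖ := by
    conv_lhs => rw [← hi, Matrix.mul_apply]
    refine (norm_sum_le _ _).trans (le_of_eq ?_)
    refine Finset.sum_congr rfl fun k _ => ?_
    rw [norm_mul, herm_norm hh i k]
  calc ‖W i j‖ ^ 2 ≤ (∑ k, ‖W k i‖ * ‖W k j‖) ^ 2 := by gcongr
    _ ≤ (∑ k, ‖W k i‖ ^ 2) * ∑ k, ‖W k j‖ ^ 2 := Finset.sum_mul_sq_le_sq_mul_sq _ _ _
    _ = _ := by rw [proj_row hi hh, proj_row hi hh]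

theorem final_real (β γ t x z μ p m n2 : ℝ) (hβ : 0 ≤ β) (hγ : 0 ≤ γ) (ht : t = β + γ)
    (hx : 0 ≤ x) (hμ : 0 ≤ μ) (hz : 0 ≤ z)
    (hs : x + μ + z = 1) (hp : p ^ 2 ≤ β * x) (hm : m ^ 2 ≤ γ * μ)
    (hn : β - t * β ≤ n2) (hzx : t ≤ z * x) : -t ≤ n2 - 2 * ((p + m) * p) := by
  have h1 : (p * m) ^ 2 ≤ (β * x * μ) * γ := by
    have := mul_le_mul hp hm (sq_nonneg _) (by positivity)
    nlinarith
  have h2 : 2 * (p * m) ≤ β * x * μ + γ := by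
    have hb : 0 ≤ β * x * μ := by positivity
    apply le_of_sq_le_sq _ (by positivity)
    nlinarith [sq_nonneg (β * x * μ - γ)]
  have h3 : 0 ≤ 2 - t - 2 * x - x * μ := by
    have : μ = 1 - x - z := by linarith
    subst this
    have hx1 : x ≤ 1 := by linarith
    nlinarith [mul_nonneg (sub_nonneg.2 hx1) (show (0:ℝ) ≤ 2 - x by linarith)]
  nlinarith [mul_nonneg hβ h3]

theorem comb {W : Matrix n n ℂ} (hi : W * W = W) (hh : Wᴴ = W) (v : n → ℂ)
    (hv : ∑ i, ‖v i‖ ^ 2 = 1) (hWv : W *ᵥ v = 0) (z x : n → ℝ)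
    (hz : ∀ i, z i = 0 ∨ z i = 1) (hx : ∀ i, x i = 0 ∨ x i = 1) (hxz : ∀ i, z i * x i = 0)
    (ht : ∑ i, (1 - z i) * (W i i).re ≤ (∑ i, z i * ‖v i‖ ^ 2) * ∑ i, x i * ‖v i‖ ^ 2) :
    (∑ i, z i * ‖v i‖ ^ 2) * (∑ i, x i * ‖v i‖ ^ 2) - ∑ i, (1 - z i) * (W i i).re ≤
      ∑ i, ∑ j, z i * (x j * ‖(W + vecMulVec v (star v)) i j‖ ^ 2) := by
  have hz0 : ∀ i, 0 ≤ z i := fun i => by rcases hz i with h | h <;> simp [h]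
  have hx0 : ∀ i, 0 ≤ x i := fun i => by rcases hx i with h | h <;> simp [h]
  have hz1 : ∀ i, 0 ≤ 1 - z i := fun i => by rcases hz i with h | h <;> simp [h]
  have hm0 : ∀ i, 0 ≤ 1 - z i - x i := fun i => by
    have := hxz i
    rcases hz i with h | h <;> rcases hx i with h' | h' <;> simp_all
  have hxx : ∀ i, x i * x i = x i := fun i => by rcases hx i with h | h <;> simp [h]
  have hmm : ∀ i, (1 - z i - x i) * (1 - z i - x i) = 1 - z i - x i := fun i => by
    have := hxz i
    rcases hz i with h | h <;> rcases hx i with h' | h' <;> simp_all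
  have hd0 : ∀ i, 0 ≤ (W i i).re := fun i => by
    rw [← proj_row hi hh]; positivity
  have hent : ∀ i j, ‖W i j‖ ≤ √(W i i).re * √(W j j).re := fun i j => by
    rw [← Real.sqrt_mul (hd0 i)]
    exact Real.le_sqrt_of_sq_le (proj_entry hi hh i j)
  have cs : ∀ a : n → ℝ, (∀ i, a i * a i = a i) →
      (∑ i, a i * (√(W i i).re * ‖v i‖)) ^ 2 ≤
        (∑ i, a i * (W i i).re) * ∑ i, a i * ‖v i‖ ^ 2 := fun a ha => by
    have := Finset.sum_mul_sq_le_sq_mul_sq Finset.univ (fun i => a i * √(W i i).re)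
      (fun i => a i * ‖v i‖)
    have e1 : ∑ i, a i * (√(W i i).re * ‖v i‖) = ∑ i, a i * √(W i i).re * (a i * ‖v i‖) :=
      Finset.sum_congr rfl fun i _ => by
        linear_combination (-√(W i i).re * ‖v i‖) * ha i
    have e2 : ∑ i, a i * (W i i).re = ∑ i, (a i * √(W i i).re) ^ 2 :=
      Finset.sum_congr rfl fun i _ => by
        rw [mul_pow, Real.sq_sqrt (hd0 i)]
        linear_combination -(W i i).re * ha i
    have e3 : ∑ i, a i * ‖v i‖ ^ 2 = ∑ i, (a i * ‖v i‖) ^ 2 :=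
      Finset.sum_congr rfl fun i _ => by
        linear_combination -‖v i‖ ^ 2 * ha i
    rw [e1, e2, e3]
    exact this
  -- cross term
  let c : n → n → ℝ := fun i j => (star (W i j) * (v i * star (v j))).re
  have hexp : ∀ i j, ‖(W + vecMulVec v (star v)) i j‖ ^ 2
      = ‖W i j‖ ^ 2 + 2 * c i j + ‖v i‖ ^ 2 * ‖v j‖ ^ 2 := fun i j => by
    have : (W + vecMulVec v (star v)) i j = W i j + v i * star (v j) := by
      simp [vecMulVec_apply]
    rw [this]
    simp only [c, ← Complex.normSq_eq_norm_sq, Complex.normSq_apply, RCLike.star_def,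
      Complex.add_re, Complex.add_im, Complex.mul_re, Complex.mul_im, Complex.conj_re,
      Complex.conj_im]
    ring
  have hcb : ∀ i j, c i j ≤ (√(W i i).re * ‖v i‖) * (√(W j j).re * ‖v j‖) := fun i j => by
    have h1 : |c i j| ≤ ‖W i j‖ * (‖v i‖ * ‖v j‖) := by
      refine (Complex.abs_re_le_norm _).trans (le_of_eq ?_)
      simp
    have h2 := le_abs_self (c i j)
    have h3 := mul_le_mul_of_nonneg_right (hent i j)
      (mul_nonneg (norm_nonneg (v i)) (norm_nonneg (v j)))
    calc _ ≤ _ := h2.trans (h1.trans h3)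
      _ = _ := by ring
  have hc0 : ∀ j, ∑ i, c i j = 0 := fun j => by
    have h1 : ∑ i, W j i * v i = 0 := congrFun hWv j
    have h2 : ∑ i, star (W i j) * (v i * star (v j)) = 0 := by
      have : ∀ i, star (W i j) * (v i * star (v j)) = (W j i * v i) * star (v j) := fun i => by
        have : W j i = star (W i j) := by
          conv_lhs => rw [← hh]
          rfl
        rw [this]; ring
      simp_rw [this]
      rw [← Finset.sum_mul, h1, zero_mul]
    simp only [c]
    rw [← Complex.re_sum, h2, Complex.zero_re]
  set β := ∑ i, x i * (W i i).re with hβ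
  set γ := ∑ i, (1 - z i - x i) * (W i i).re with hγ
  set t := ∑ i, (1 - z i) * (W i i).re with htd
  set xs := ∑ i, x i * ‖v i‖ ^ 2 with hxs
  set zs := ∑ i, z i * ‖v i‖ ^ 2 with hzs
  set μ := ∑ i, (1 - z i - x i) * ‖v i‖ ^ 2 with hμ
  set p := ∑ i, x i * (√(W i i).re * ‖v i‖) with hp
  set m := ∑ i, (1 - z i - x i) * (√(W i i).re * ‖v i‖) with hm
  have hq : ∑ i, ∑ j, z i * (x j * ‖(W + vecMulVec v (star v)) i j‖ ^ 2)
      = (∑ j, ∑ i, z i * (x j * ‖W i j‖ ^ 2)) + 2 * (∑ j, ∑ i, z i * (x j * c i j))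
        + zs * xs := by
    rw [hzs, hxs, Finset.sum_mul_sum, Finset.sum_comm, Finset.mul_sum,
      Finset.sum_comm (s := Finset.univ) (t := Finset.univ)
        (f := fun i j => z i * ‖v i‖ ^ 2 * (x j * ‖v j‖ ^ 2))]
    simp_rw [Finset.mul_sum, ← Finset.sum_add_distrib]
    refine Finset.sum_congr rfl fun j _ => Finset.sum_congr rfl fun i _ => ?_
    rw [hexp]; ring
  have hn : β - t * β ≤ ∑ j, ∑ i, z i * (x j * ‖W i j‖ ^ 2) := by
    have e1 : ∑ j, ∑ i, z i * (x j * ‖W i j‖ ^ 2)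
        = β - ∑ j, ∑ i, (1 - z i) * (x j * ‖W i j‖ ^ 2) := by
      rw [hβ, ← Finset.sum_sub_distrib]
      refine Finset.sum_congr rfl fun j _ => ?_
      rw [← proj_row hi hh, Finset.mul_sum, ← Finset.sum_sub_distrib]
      exact Finset.sum_congr rfl fun i _ => by ring
    have e2 : ∑ j, ∑ i, (1 - z i) * (x j * ‖W i j‖ ^ 2) ≤ t * β := by
      rw [htd, hβ, Finset.sum_mul_sum, Finset.sum_comm]
      refine Finset.sum_le_sum fun i _ => Finset.sum_le_sum fun j _ => ?_
      have := mul_le_mul_of_nonneg_left (proj_entry hi hh i j) (mul_nonneg (hz1 i) (hx0 j))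
      linarith
    linarith
  have hS2 : -((p + m) * p) ≤ ∑ j, ∑ i, z i * (x j * c i j) := by
    have e1 : ∑ j, ∑ i, z i * (x j * c i j) = - ∑ j, ∑ i, (1 - z i) * (x j * c i j) := by
      rw [eq_neg_iff_add_eq_zero, ← Finset.sum_add_distrib]
      refine Finset.sum_eq_zero fun j _ => ?_
      rw [← Finset.sum_add_distrib]
      calc _ = x j * ∑ i, c i j := by
            rw [Finset.mul_sum]; exact Finset.sum_congr rfl fun i _ => by ring
        _ = 0 := by rw [hc0, mul_zero]
    have e2 : p + m = ∑ i, (1 - z i) * (√(W i i).re * ‖v i‖) := by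
      rw [hp, hm, ← Finset.sum_add_distrib]
      exact Finset.sum_congr rfl fun i _ => by ring
    rw [e1, e2, hp, Finset.sum_mul_sum, Finset.sum_comm, ← Finset.sum_neg_distrib,
      ← Finset.sum_neg_distrib]
    refine Finset.sum_le_sum fun i _ => ?_
    rw [← Finset.sum_neg_distrib, ← Finset.sum_neg_distrib]
    refine Finset.sum_le_sum fun j _ => ?_
    have := mul_le_mul_of_nonneg_left (hcb j i) (mul_nonneg (hz1 j) (hx0 i))
    linarith
  have hsum : xs + μ + zs = 1 := by
    refine Eq.trans ?_ hv
    rw [hxs, hμ, hzs, ← Finset.sum_add_distrib, ← Finset.sum_add_distrib]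
    exact Finset.sum_congr rfl fun i _ => by ring
  have htβ : t = β + γ := by
    rw [htd, hβ, hγ, ← Finset.sum_add_distrib]
    exact Finset.sum_congr rfl fun i _ => by ring
  have key := final_real β γ t xs zs μ p m _
    (Finset.sum_nonneg fun i _ => mul_nonneg (hx0 i) (hd0 i))
    (Finset.sum_nonneg fun i _ => mul_nonneg (hm0 i) (hd0 i)) htβ
    (Finset.sum_nonneg fun i _ => mul_nonneg (hx0 i) (sq_nonneg _))
    (Finset.sum_nonneg fun i _ => mul_nonneg (hm0 i) (sq_nonneg _))
    (Finset.sum_nonneg fun i _ => mul_nonneg (hz0 i) (sq_nonneg _))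
    hsum (cs x hxx) (cs _ hmm) hn ht
  rw [hq]
  linarith

theorem add_vec_proj {W : Matrix n n ℂ} (hi : W * W = W) (hh : Wᴴ = W) (v : n → ℂ)
    (hv : star v ⬝ᵥ v = 1) (hWv : W *ᵥ v = 0) :
    (W + vecMulVec v (star v)) * (W + vecMulVec v (star v)) = W + vecMulVec v (star v) ∧
    (W + vecMulVec v (star v))ᴴ = W + vecMulVec v (star v) := by
  have hvW : star v ᵥ* W = 0 := by
    have := congrArg star hWv
    rw [Matrix.star_mulVec, hh, star_zero] at this
    exact this
  constructor
  · rw [add_mul, mul_add, mul_add, hi, Matrix.mul_vecMulVec, hWv, Matrix.vecMulVec_mul, hvW,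
      Matrix.vecMulVec_mul_vecMulVec, hv]
    simp
  · rw [Matrix.conjTranspose_add, hh, Matrix.conjTranspose_vecMulVec, star_star]

theorem relP_add {W : Matrix n n ℂ} (hi : W * W = W) (hh : Wᴴ = W) (v : n → ℂ)
    (hv : star v ⬝ᵥ v = 1) (hWv : W *ᵥ v = 0) (r : n → ℝ) (hr : ∀ i, 0 < r i)
    (G PW : Matrix n n ℂ)
    (hG : G = W * rdiag (fun i => r i * r i) * W + (1 - W))
    (hPW : PW = rdiag r * W * G⁻¹ * (W * rdiag r))
    (y : n → ℂ) (hy : y = ((1 - PW) * rdiag r) *ᵥ v) (s : ℂ) (hs : s = star y ⬝ᵥ y) :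
    s ≠ 0 ∧ RelP r (W + vecMulVec v (star v)) (PW + s⁻¹ • vecMulVec y (star y)) := by
  obtain ⟨pd, ph, pf, -⟩ := gram_facts hi hh r hr G PW hG hPW
  have hvW : star v ᵥ* W = 0 := by
    have := congrArg star hWv
    rw [Matrix.star_mulVec, hh, star_zero] at this
    exact this
  have pid : PW * PW = PW := by
    have e : PW * PW = PW * (rdiag r * W) * (G⁻¹ * (W * rdiag r)) := by
      nth_rewrite 2 [hPW]; simp only [mul_assoc]
    rw [e, pf, hPW]; simp only [mul_assoc]
  have hy' : y = rdiag r *ᵥ v - PW *ᵥ (rdiag r *ᵥ v) := by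
    rw [hy, ← Matrix.mulVec_mulVec, Matrix.sub_mulVec, Matrix.one_mulVec]
  have hPy : PW *ᵥ y = 0 := by
    rw [hy', Matrix.mulVec_sub, Matrix.mulVec_mulVec _ PW PW, pid, sub_self]
  have hyP : star y ᵥ* PW = 0 := by
    have := congrArg star hPy
    rw [Matrix.star_mulVec, ph, star_zero] at this
    exact this
  have hyRW : star y ᵥ* (rdiag r * W) = 0 := by
    rw [← pf, ← Matrix.vecMul_vecMul, hyP, Matrix.zero_vecMul]
  have hRv : rdiag r *ᵥ v = y + PW *ᵥ (rdiag r *ᵥ v) := by rw [hy']; abel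
  have hyRv : star y ⬝ᵥ (rdiag r *ᵥ v) = s := by
    rw [hRv, dotProduct_add, Matrix.dotProduct_mulVec, hyP, zero_dotProduct, add_zero, hs]
  obtain ⟨g, hg⟩ : ∃ g, g = (G⁻¹ * (W * rdiag r)) *ᵥ (rdiag r *ᵥ v) := ⟨_, rfl⟩
  have hyR : y = rdiag r *ᵥ (v - W *ᵥ g) := by
    rw [hy', hPW, hg, Matrix.mulVec_sub]
    simp only [Matrix.mulVec_mulVec, mul_assoc]
  have hs0 : s ≠ 0 := by
    intro h0
    rw [hs] at h0
    have hy0 : y = 0 := dotProduct_star_self_eq_zero.1 h0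
    have hk : v - W *ᵥ g = 0 := by
      funext i
      have := congrFun (hyR.symm.trans hy0) i
      rw [rdiag, Matrix.mulVec_diagonal] at this
      rcases mul_eq_zero.1 this with h | h
      · exact absurd (Complex.ofReal_eq_zero.1 h) (hr i).ne'
      · exact h
    have hvg : v = W *ᵥ g := sub_eq_zero.1 hk
    have : W *ᵥ v = v := by
      rw [hvg, Matrix.mulVec_mulVec, hi]
    rw [hWv] at this
    rw [← this] at hv
    simp at hv
  have hVk : (W + vecMulVec v (star v)) *ᵥ (v - W *ᵥ g) = v - W *ᵥ g := by
    have e : star v ⬝ᵥ (v - W *ᵥ g) = 1 := by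
      rw [dotProduct_sub, hv, Matrix.dotProduct_mulVec, hvW, zero_dotProduct, sub_zero]
    rw [Matrix.add_mulVec, Matrix.vecMulVec_mulVec, e, Matrix.mulVec_sub, hWv,
      Matrix.mulVec_mulVec, hi]
    simp [sub_eq_add_neg, add_comm]
  have hVW : (W + vecMulVec v (star v)) * W = W := by
    rw [add_mul, hi, Matrix.vecMulVec_mul, hvW]; simp
  have hsr : star s = s := by
    rw [hs]
    exact (Matrix.star_dotProduct _ _).symm.trans rfl
  refine ⟨hs0, ?_, ?_, W * G⁻¹ * (W * rdiag r) + s⁻¹ • vecMulVec (v - W *ᵥ g) (star y), ?_⟩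
  · rw [Matrix.conjTranspose_add, ph, Matrix.conjTranspose_smul, Matrix.conjTranspose_vecMulVec,
      star_star, star_inv₀, hsr]
  · have e1 : (PW + s⁻¹ • vecMulVec y (star y)) * (rdiag r * W) = rdiag r * W := by
      rw [add_mul, pf, Matrix.smul_mul, Matrix.vecMulVec_mul, hyRW]; simp
    have e2 : (PW + s⁻¹ • vecMulVec y (star y)) *ᵥ (rdiag r *ᵥ v) = rdiag r *ᵥ v := by
      rw [Matrix.add_mulVec, Matrix.smul_mulVec, Matrix.vecMulVec_mulVec, hyRv]
      conv_rhs => rw [hRv]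
      rw [add_comm]
      congr 1
      funext i
      simp only [Pi.smul_apply, MulOpposite.smul_eq_mul_unop, MulOpposite.unop_op, smul_eq_mul]
      field_simp
    rw [mul_add, mul_add, e1, Matrix.mul_vecMulVec, Matrix.mul_vecMulVec, e2]
  · have e1 : rdiag r * (W + vecMulVec v (star v)) * (W * G⁻¹ * (W * rdiag r)) = PW := by
      rw [mul_assoc, ← mul_assoc _ (W * G⁻¹), ← mul_assoc _ W G⁻¹, hVW, hPW]
      simp only [mul_assoc]
    rw [mul_add, e1, Matrix.mul_smul, Matrix.mul_vecMulVec, ← Matrix.mulVec_mulVec, hVk, ← hyR]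

theorem trace_rdiag (d : n → ℝ) (M : Matrix n n ℂ) :
    (rdiag d * M).trace.re = ∑ i, d i * (M i i).re := by
  simp [Matrix.trace, rdiag, Matrix.diagonal_mul]

theorem final_real2 (τ q t Z X PZ WZ PX WX yz yx : ℝ) (τ0 : 0 ≤ τ) (τ1 : τ ≤ 1) (q0 : 0 ≤ q)
    (t0 : 0 ≤ t) (Z0 : 0 ≤ Z) (X0 : 0 ≤ X)
    (KZ : WZ + Z + τ * q ≤ PZ + yz) (KX : PX + yx ≤ WX + X - τ * q)
    (cb : t ≤ Z * X → Z * X - t ≤ q) (f1 : PZ ≤ WZ + t) (f2 : 0 ≤ PX) (f3 : WX ≤ t) :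
    yx ≤ X * (1 - τ * Z) + 2 * t ∧ Z * (1 + τ * X) - 2 * t ≤ yz := by
  have main : τ * (Z * X) - t ≤ τ * q := by
    by_cases h : t ≤ Z * X
    · have h1 := mul_le_mul_of_nonneg_left (cb h) τ0
      have h2 := mul_le_mul_of_nonneg_right τ1 t0
      linarith
    · push Not at h
      have h1 := mul_nonneg τ0 q0
      have h2 := mul_le_mul_of_nonneg_right τ1 (mul_nonneg Z0 X0)
      linarith
  constructor
  · linarith
  · linarith

theorem core {W : Matrix n n ℂ} (hi : W * W = W) (hh : Wᴴ = W) (v : n → ℂ)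
    (hv : ∑ i, ‖v i‖ ^ 2 = 1) (hWv : W *ᵥ v = 0) (r : n → ℝ) (hr : ∀ i, 0 < r i)
    (G PW : Matrix n n ℂ)
    (hG : G = W * rdiag (fun i => r i * r i) * W + (1 - W))
    (hPW : PW = rdiag r * W * G⁻¹ * (W * rdiag r))
    (y : n → ℂ) (hy : y = ((1 - PW) * rdiag r) *ᵥ v)
    (z x : n → ℝ) (hz : ∀ i, z i = 0 ∨ z i = 1) (hx : ∀ i, x i = 0 ∨ x i = 1)
    (hxz : ∀ i, z i * x i = 0) (a b : ℝ) (ha : 0 < a) (hb : 0 < b) (hba : b ≤ a)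
    (hza : ∀ i, z i = 1 → a ≤ r i) (hza' : ∀ i, z i = 0 → r i ≤ a)
    (hxb : ∀ i, x i = 1 → r i ≤ b) (hxb' : ∀ i, x i = 0 → b ≤ r i) :
    (∑ i, ‖y i‖ ^ 2)⁻¹ * (∑ i, x i * ‖y i‖ ^ 2) ≤
      (∑ i, x i * ‖v i‖ ^ 2) * (1 - (1 - b ^ 2 / a ^ 2) * ∑ i, z i * ‖v i‖ ^ 2)
        + 2 * ∑ i, (1 - z i) * (W i i).re ∧
    (∑ i, z i * ‖v i‖ ^ 2) * (1 + (1 - b ^ 2 / a ^ 2) * ∑ i, x i * ‖v i‖ ^ 2)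
        - 2 * ∑ i, (1 - z i) * (W i i).re ≤
      (∑ i, ‖y i‖ ^ 2)⁻¹ * (∑ i, z i * ‖y i‖ ^ 2) := by
  have hz0 : ∀ i, 0 ≤ z i := fun i => by rcases hz i with h | h <;> simp [h]
  have hx0 : ∀ i, 0 ≤ x i := fun i => by rcases hx i with h | h <;> simp [h]
  have hz1 : ∀ i, 0 ≤ 1 - z i := fun i => by rcases hz i with h | h <;> simp [h]
  have sn : ∀ u : n → ℂ, star u ⬝ᵥ u = ((∑ i, ‖u i‖ ^ 2 : ℝ) : ℂ) := fun u => by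
    rw [dotProduct]; push_cast
    refine Finset.sum_congr rfl fun i _ => ?_
    rw [← Complex.conj_mul']; rfl
  have hv' : star v ⬝ᵥ v = 1 := by rw [sn, hv]; simp
  obtain ⟨s, hs⟩ : ∃ s : ℝ, s = ∑ i, ‖y i‖ ^ 2 := ⟨_, rfl⟩
  obtain ⟨hs0, rel⟩ := relP_add hi hh v hv' hWv r hr G PW hG hPW y hy (s : ℂ) (by rw [sn, hs])
  obtain ⟨Vi, Vh⟩ := add_vec_proj hi hh v hv' hWv
  obtain ⟨pd, ph, pf, gc⟩ := gram_facts hi hh r hr G PW hG hPW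
  have hdet : IsUnit G.det := (Matrix.isUnit_iff_isUnit_det _).1 pd.isUnit
  have hd0 : ∀ i, 0 ≤ (W i i).re := fun i => by
    rw [← proj_row hi hh]; positivity
  have pid : PW * PW = PW := by
    have e : PW * PW = PW * (rdiag r * W) * (G⁻¹ * (W * rdiag r)) := by
      nth_rewrite 2 [hPW]; simp only [mul_assoc]
    rw [e, pf, hPW]; simp only [mul_assoc]
  have hp0 : ∀ i, 0 ≤ (PW i i).re := fun i => by
    rw [← proj_row pid ph]; positivity
  have htrP : ∑ i, (PW i i).re = ∑ i, (W i i).re := by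
    have h1 : PW.trace = W.trace := by
      have e1 : PW.trace = (G⁻¹ * (W * rdiag (fun i => r i * r i) * W)).trace := by
        rw [hPW, Matrix.trace_mul_comm, ← rdiag_mul, ← mul_assoc, Matrix.trace_mul_comm]
        simp only [mul_assoc]
      have e2 : W * rdiag (fun i => r i * r i) * W = G - (1 - W) := by rw [hG]; abel
      rw [e1, e2, mul_sub, gc, Matrix.nonsing_inv_mul _ hdet, sub_sub_cancel]
    have := congrArg Complex.re h1
    simpa [Matrix.trace] using this
  have τ0 : 0 ≤ 1 - b ^ 2 / a ^ 2 := by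
    rw [sub_nonneg, div_le_one (by positivity)]; gcongr
  have τ1 : 1 - b ^ 2 / a ^ 2 ≤ 1 := by
    have : 0 ≤ b ^ 2 / a ^ 2 := by positivity
    linarith
  obtain ⟨τ, hτ⟩ : ∃ τ, τ = 1 - b ^ 2 / a ^ 2 := ⟨_, rfl⟩
  rw [← hτ] at τ0 τ1
  rw [← hτ]
  obtain ⟨V, hV⟩ : ∃ V, V = W + vecMulVec v (star v) := ⟨_, rfl⟩
  rw [← hV] at Vi Vh rel
  -- Z inequality
  have KZ : (rdiag z * V).trace.re + τ * ∑ i, ∑ j, z i * (x j * ‖V i j‖ ^ 2)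
      ≤ (rdiag z * (PW + (s : ℂ)⁻¹ • vecMulVec y (star y))).trace.re := by
    obtain ⟨h1, h2, S, h3⟩ := rel.scale a⁻¹ (inv_ne_zero ha.ne')
    rw [← qform Vi Vh]
    refine keyZ Vi Vh h1 _ z x τ τ0 (fun i => mul_pos (inv_pos.2 ha) (hr i)) hz hx0 ?_ ?_ h2 h3
    · intro i
      rcases hz i with h | h
      · simp [h]
      · have : 1 ≤ a⁻¹ * r i := by
          rw [inv_mul_eq_div, one_le_div ha]; exact hza i h
        rw [h]; nlinarith
    · intro i
      rcases hz i with h | h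
      · have e : (a⁻¹ * r i) * (a⁻¹ * r i) = r i ^ 2 / a ^ 2 := by field_simp
        have hri := (hr i).le
        rw [h, e, hτ]
        rcases hx i with h' | h'
        · have : r i ^ 2 / a ^ 2 ≤ 1 := by
            rw [div_le_one (by positivity)]
            have := hza' i h
            gcongr
          rw [h']; linarith
        · have : r i ^ 2 / a ^ 2 ≤ b ^ 2 / a ^ 2 := by
            have := hxb i h'
            gcongr
          rw [h']; linarith
      · have := hxz i
        rw [h, one_mul] at this
        simp [h, this]
  have KX : (rdiag x * (PW + (s : ℂ)⁻¹ • vecMulVec y (star y))).trace.re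
      ≤ (rdiag x * V).trace.re - τ * ∑ i, ∑ j, z i * (x j * ‖V i j‖ ^ 2) := by
    refine keyX Vi Vh _ z x τ τ0 (fun i => mul_pos (inv_pos.2 hb) (hr i)) hx hz0 hxz ?_ ?_
      (rel.scale b⁻¹ (inv_ne_zero hb.ne'))
    · intro i
      rcases hx i with h | h
      · simp [h]
      · have : 1 ≤ (b⁻¹ * r i)⁻¹ := by
          rw [mul_inv, inv_inv, ← div_eq_mul_inv, one_le_div (hr i)]; exact hxb i h
        rw [h]; nlinarith
    · intro i
      rcases hx i with h | h
      · have hri := hr i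
        have e : (b⁻¹ * r i)⁻¹ * (b⁻¹ * r i)⁻¹ = b ^ 2 / r i ^ 2 := by field_simp
        rw [h, e, hτ]
        rcases hz i with h' | h'
        · have : b ^ 2 / r i ^ 2 ≤ 1 := by
            rw [div_le_one (by positivity)]
            have := hxb' i h
            gcongr
          rw [h']; linarith
        · have : b ^ 2 / r i ^ 2 ≤ b ^ 2 / a ^ 2 := by
            have := hza i h'
            gcongr
          rw [h']; linarith
      · have := hxz i
        rw [h, mul_one] at this
        simp [h, this]
  have eV : ∀ d : n → ℝ, (rdiag d * V).trace.re
      = ∑ i, d i * (W i i).re + ∑ i, d i * ‖v i‖ ^ 2 := fun d => by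
    rw [trace_rdiag, ← Finset.sum_add_distrib]
    refine Finset.sum_congr rfl fun i _ => ?_
    have : V i i = W i i + ((‖v i‖ ^ 2 : ℝ) : ℂ) := by
      rw [hV, Matrix.add_apply, vecMulVec_apply]
      push_cast
      rw [← Complex.mul_conj']; rfl
    rw [this, Complex.add_re, Complex.ofReal_re]; ring
  have eP : ∀ d : n → ℝ, (rdiag d * (PW + (s : ℂ)⁻¹ • vecMulVec y (star y))).trace.re
      = ∑ i, d i * (PW i i).re + s⁻¹ * ∑ i, d i * ‖y i‖ ^ 2 := fun d => by
    rw [trace_rdiag, Finset.mul_sum, ← Finset.sum_add_distrib]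
    refine Finset.sum_congr rfl fun i _ => ?_
    have : (PW + (s : ℂ)⁻¹ • vecMulVec y (star y)) i i
        = PW i i + ((s⁻¹ * ‖y i‖ ^ 2 : ℝ) : ℂ) := by
      rw [Matrix.add_apply, Matrix.smul_apply, vecMulVec_apply]
      push_cast
      rw [← Complex.mul_conj']; rfl
    rw [this, Complex.add_re, Complex.ofReal_re]; ring
  rw [eV, eP] at KZ KX
  rw [← hs]
  have cb := comb hi hh v hv hWv z x hz hx hxz
  rw [← hV] at cb
  have q0 : 0 ≤ ∑ i, ∑ j, z i * (x j * ‖V i j‖ ^ 2) :=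
    Finset.sum_nonneg fun i _ => Finset.sum_nonneg fun j _ =>
      mul_nonneg (hz0 i) (mul_nonneg (hx0 j) (sq_nonneg _))
  have f1 : ∑ i, z i * (PW i i).re ≤ ∑ i, z i * (W i i).re + ∑ i, (1 - z i) * (W i i).re := by
    rw [← Finset.sum_add_distrib]
    calc _ ≤ ∑ i, (PW i i).re := Finset.sum_le_sum fun i _ => by
            nlinarith [mul_nonneg (hz1 i) (hp0 i)]
      _ = ∑ i, (W i i).re := htrP
      _ = _ := Finset.sum_congr rfl fun i _ => by ring
  have f2 : 0 ≤ ∑ i, x i * (PW i i).re :=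
    Finset.sum_nonneg fun i _ => mul_nonneg (hx0 i) (hp0 i)
  have f3 : ∑ i, x i * (W i i).re ≤ ∑ i, (1 - z i) * (W i i).re := by
    refine Finset.sum_le_sum fun i _ => mul_le_mul_of_nonneg_right ?_ (hd0 i)
    have := hxz i
    rcases hz i with h | h <;> rcases hx i with h' | h' <;> simp_all
  have t0 : 0 ≤ ∑ i, (1 - z i) * (W i i).re :=
    Finset.sum_nonneg fun i _ => mul_nonneg (hz1 i) (hd0 i)
  exact final_real2 _ _ _ _ _ _ _ _ _ _ _ τ0 τ1 q0 t0
    (Finset.sum_nonneg fun i _ => mul_nonneg (hz0 i) (sq_nonneg _))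
    (Finset.sum_nonneg fun i _ => mul_nonneg (hx0 i) (sq_nonneg _)) KZ KX cb f1 f2 f3

end Aux

theorem sqNorm_circ {L : ℕ} (S : Matrix (Fin L) (Fin L) ℂ) (v : Fin L → ℂ) (i : Fin L) :
    ‖circAct S v i‖ ^ 2 = (∑ i, ‖(S *ᵥ v) i‖ ^ 2)⁻¹ * ‖(S *ᵥ v) i‖ ^ 2 := by
  have h0 : 0 ≤ sqNorm (S *ᵥ v) := Finset.sum_nonneg fun i _ => sq_nonneg _
  rw [circAct, Pi.smul_apply, smul_eq_mul, norm_mul, mul_pow, norm_inv, Complex.norm_real,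
    inv_pow, Real.norm_eq_abs, sq_abs, vNorm, Real.sq_sqrt h0]
  rfl

theorem frame_trace {L : ℕ} (D : ℕ) (W : Matrix (Fin L) (Fin L) ℂ) :
    ((basisFrame L (L - D) 0)ᴴ * W * basisFrame L (L - D) 0).trace.re
      = ∑ i : Fin L, (1 - if L - D ≤ (i : ℕ) then (1:ℝ) else 0) * (W i i).re := by
  have e : basisFrame L (L - D) 0 * (basisFrame L (L - D) 0)ᴴ
      = rdiag fun i : Fin L => (1 - if L - D ≤ (i : ℕ) then (1:ℝ) else 0) := by
    ext i j
    rw [Matrix.mul_apply]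
    simp only [basisFrame, Matrix.conjTranspose_apply, Matrix.of_apply, zero_add]
    by_cases hij : i = j
    · subst hij
      rw [rdiag, Matrix.diagonal_apply_eq]
      by_cases h : L - D ≤ (i : ℕ)
      · rw [if_pos h, Finset.sum_eq_zero]
        · simp
        · intro k _
          have := k.2
          rw [if_neg (by omega)]; simp
      · rw [if_neg h, Finset.sum_eq_single ⟨i, by omega⟩]
        · simp
        · intro k _ hk
          rw [if_neg (fun h' => hk (Fin.ext h'.symm))]; simp
        · simp
    · rw [rdiag, Matrix.diagonal_apply_ne _ hij]
      refine Finset.sum_eq_zero fun k _ => ?_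
      by_cases h1 : (i : ℕ) = k
      · have h2 : ¬ (j : ℕ) = k := fun h => hij (Fin.ext (h1.trans h.symm))
        simp [h2]
      · simp [h1]
  rw [Matrix.mul_assoc, Matrix.trace_mul_comm, Matrix.mul_assoc, e, Matrix.trace_mul_comm,
    trace_rdiag]

/-- contraction and growth under the hyperbolic action combined with the
orthogonal projection: with `τ = η(D,E)` and `ζ̂^⊥` the frame of the first `L−D` standard
basis vectors,
`‖𝔵(((ℛ·W)^⊥ℛ)∘v)‖² ≤ ‖𝔵(v)‖²[1 − τ‖𝔷(v)‖²] + 2 tr[(ζ̂^⊥)*Wζ̂^⊥]` and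
`‖𝔷(((ℛ·W)^⊥ℛ)∘v)‖² ≥ ‖𝔷(v)‖²[1 + τ‖𝔵(v)‖²] − 2 tr[(ζ̂^⊥)*Wζ̂^⊥]`. -/
theorem statement10 (L D E w : ℕ) (hD : 1 ≤ D) (hDE : D < E) (hE : E ≤ L)
    (κ : ℕ → ℝ)
    (hκpos : ∀ i, 1 ≤ i → i ≤ L → 0 < κ i)
    (hκmono : ∀ i j, 1 ≤ i → i ≤ j → j ≤ L → κ j ≤ κ i)
    (W : Matrix (Fin L) (Fin L) ℂ) (hW : IsProjOfRank w W)
    (v : Fin L → ℂ) (hv : sqNorm v = 1) (hWv : W.mulVec v = 0) :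
    xSq E (circAct ((1 - grAct (Rmat κ L) W) * Rmat κ L) v) ≤
      xSq E v * (1 - eta κ D E * zSq D v)
        + 2 * ((basisFrame L (L - D) 0)ᴴ * W * basisFrame L (L - D) 0).trace.re ∧
    zSq D (circAct ((1 - grAct (Rmat κ L) W) * Rmat κ L) v) ≥
      zSq D v * (1 + eta κ D E * xSq E v)
        - 2 * ((basisFrame L (L - D) 0)ᴴ * W * basisFrame L (L - D) 0).trace.re := by
  classical
  obtain ⟨hi, hh, -⟩ := hW
  let r : Fin L → ℝ := fun i => κ (L - (i : ℕ))
  let z : Fin L → ℝ := fun i => if L - D ≤ (i : ℕ) then 1 else 0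
  let x : Fin L → ℝ := fun i => if (i : ℕ) < L - E then 1 else 0
  have hr : ∀ i, 0 < r i := fun i => hκpos _ (by have := i.2; omega) (by omega)
  have hR : Rmat κ L = rdiag r := rfl
  have hgr : grAct (Rmat κ L) W
      = rdiag r * W * (W * rdiag (fun i => r i * r i) * W + (1 - W))⁻¹ * (W * rdiag r) := by
    rw [grAct, hR, rdiag_herm, mul_assoc W (rdiag r), rdiag_mul]
  have hz : ∀ i, z i = 0 ∨ z i = 1 := fun i => by
    by_cases h : L - D ≤ (i : ℕ) <;> simp only [z, h, if_true, if_false, true_or, or_true]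
  have hx : ∀ i, x i = 0 ∨ x i = 1 := fun i => by
    by_cases h : (i : ℕ) < L - E <;> simp [x, h]
  have hxz : ∀ i, z i * x i = 0 := fun i => by
    by_cases h : L - D ≤ (i : ℕ)
    · have : ¬ (i : ℕ) < L - E := by omega
      simp [x, this]
    · simp only [z, if_neg h, zero_mul]
  have hz1 : ∀ i, z i = 1 → L - D ≤ (i : ℕ) := fun i hi => by
    by_contra h
    simp only [z, if_neg h] at hi
    norm_num at hi
  have hz0 : ∀ i, z i = 0 → ¬ L - D ≤ (i : ℕ) := fun i hi h => by
    simp only [z, if_pos h] at hi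
    norm_num at hi
  have hx1 : ∀ i, x i = 1 → (i : ℕ) < L - E := fun i hi => by
    by_contra h
    simp [x, h] at hi
  have hx0 : ∀ i, x i = 0 → ¬ (i : ℕ) < L - E := fun i hi h => by
    simp [x, h] at hi
  have main := core hi hh v hv hWv r hr _ _ rfl hgr _ rfl z x hz hx hxz (κ D) (κ E)
    (hκpos _ hD (by omega)) (hκpos _ (by omega) hE) (hκmono _ _ hD hDE.le hE)
    (fun i h => hκmono _ _ (by have := i.2; omega) (by have := hz1 i h; omega) (by omega))
    (fun i h => hκmono _ _ hD (by have := hz0 i h; omega) (by omega))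
    (fun i h => hκmono _ _ (by omega) (by have := hx1 i h; omega) (by omega))
    (fun i h => hκmono _ _ (by have := i.2; omega) (by have := hx0 i h; omega) hE)
  have hxs : ∀ u : Fin L → ℂ, xSq E u = ∑ i, x i * ‖u i‖ ^ 2 := fun u =>
    Finset.sum_congr rfl fun i _ => by simp [x]
  have hzs : ∀ u : Fin L → ℂ, zSq D u = ∑ i, z i * ‖u i‖ ^ 2 := fun u =>
    Finset.sum_congr rfl fun i _ => by simp [z]
  have hc : ∀ (S : Matrix (Fin L) (Fin L) ℂ) (d : Fin L → ℝ),
      ∑ i, d i * ‖circAct S v i‖ ^ 2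
        = (∑ i, ‖(S *ᵥ v) i‖ ^ 2)⁻¹ * ∑ i, d i * ‖(S *ᵥ v) i‖ ^ 2 := fun S d => by
    rw [Finset.mul_sum]
    refine Finset.sum_congr rfl fun i _ => ?_
    rw [sqNorm_circ]; ring
  rw [frame_trace, hxs, hzs, hxs, hzs, hc, hc, hR]
  rw [hR] at main
  exact main

end
end

section
/- Let 0 < λ ≤ 2^{-6}, let 1 ≤ D < E ≤ L, let P ∈ ℂ^{L×L} with ‖P‖ ≤ 1, let W ∈ 𝔾_{L,w} and let v ∈ ℂ^L be a unit vector with Wv = 0, and assume tr[(ζ̂^⊥)*Wζ̂^⊥] ≤ 2^{-3}λ. Then ‖𝔵((((e^{λP}ℛ)·W)^⊥(e^{λP}ℛ))∘v)‖² ≤ ‖𝔵(v)‖² + (7/4)λ and ‖𝔷((((e^{λP}ℛ)·W)^⊥(e^{λP}ℛ))∘v)‖² ≥ ‖𝔷(v)‖² − (7/4)λ. -/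
open Matrix BigOperators

noncomputable section

/-- The `ℓ² → ℓ²` operator norm of a rectangular complex matrix. -/
def opNorm {m n : ℕ} (A : Matrix (Fin m) (Fin n) ℂ) : ℝ :=
  ‖LinearMap.toContinuousLinearMap (Matrix.toEuclideanLin A)‖

/-- The matrix exponential. -/
def mexp {n : ℕ} (A : Matrix (Fin n) (Fin n) ℂ) : Matrix (Fin n) (Fin n) ℂ :=
  ∑' k : ℕ, ((k.factorial : ℂ))⁻¹ • A ^ k

/-- Squared norm of the first `k` entries. -/
def topSq (k : ℕ) {L : ℕ} (v : Fin L → ℂ) : ℝ :=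
  ∑ i : Fin L, if (i : ℕ) < k then ‖v i‖ ^ 2 else 0

def botSq (k : ℕ) {L : ℕ} (v : Fin L → ℂ) : ℝ :=
  ∑ i : Fin L, if (i : ℕ) < k then 0 else ‖v i‖ ^ 2

lemma top_add_bot (k : ℕ) {L : ℕ} (v : Fin L → ℂ) : topSq k v + botSq k v = sqNorm v := by
  unfold topSq botSq sqNorm
  rw [← Finset.sum_add_distrib]
  refine Finset.sum_congr rfl fun i _ => ?_
  split_ifs <;> simp

lemma topSq_nonneg (k : ℕ) {L : ℕ} (v : Fin L → ℂ) : 0 ≤ topSq k v :=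
  Finset.sum_nonneg fun i _ => by split_ifs <;> positivity

lemma botSq_nonneg (k : ℕ) {L : ℕ} (v : Fin L → ℂ) : 0 ≤ botSq k v :=
  Finset.sum_nonneg fun i _ => by split_ifs <;> positivity

lemma sqNorm_eq {L : ℕ} (v : Fin L → ℂ) : sqNorm v = ‖(WithLp.toLp 2 v : EuclideanSpace ℂ (Fin L))‖ ^ 2 := by
  rw [EuclideanSpace.norm_sq_eq]; rfl

lemma topSq_smul (k : ℕ) {L : ℕ} (c : ℂ) (v : Fin L → ℂ) : topSq k (c • v) = ‖c‖ ^ 2 * topSq k v := by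
  unfold topSq
  rw [Finset.mul_sum]
  refine Finset.sum_congr rfl fun i _ => ?_
  split_ifs <;> simp [mul_pow]

lemma sqNorm_smul {L : ℕ} (c : ℂ) (v : Fin L → ℂ) : sqNorm (c • v) = ‖c‖ ^ 2 * sqNorm v := by
  unfold sqNorm
  rw [Finset.mul_sum]
  refine Finset.sum_congr rfl fun i _ => ?_
  simp [mul_pow]

lemma sqNorm_nonneg {L : ℕ} (v : Fin L → ℂ) : 0 ≤ sqNorm v :=
  Finset.sum_nonneg fun i _ => by positivity

lemma exp_sub_one_norm {A : Type*} [NormedRing A] [NormedAlgebra ℂ A] [CompleteSpace A] (x : A) :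
    ‖NormedSpace.exp x - 1‖ ≤ Real.exp ‖x‖ - 1 := by
  have h := NormedSpace.exp_series_hasSum_exp' (𝕂 := ℂ) x
  have h1 := (hasSum_nat_add_iff' 1).mpr h
  have g := NormedSpace.exp_series_hasSum_exp' (𝕂 := ℝ) ‖x‖
  have g1 := (hasSum_nat_add_iff' 1).mpr g
  rw [← Real.exp_eq_exp_ℝ] at g1
  simp only [Finset.range_one, Finset.sum_singleton, Nat.factorial_zero, Nat.cast_one, inv_one,
    pow_zero, one_smul] at h1 g1
  rw [← h1.tsum_eq]
  refine tsum_of_norm_bounded g1 fun n => ?_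
  rw [norm_smul]
  simp only [norm_inv, smul_eq_mul]
  rw [RCLike.norm_natCast]
  gcongr
  exact norm_pow_le' _ (Nat.succ_pos n)

section
open scoped Matrix.Norms.L2Operator

lemma mexp_eq {n : ℕ} (A : Matrix (Fin n) (Fin n) ℂ) : mexp A = NormedSpace.exp A := by
  unfold mexp
  rw [NormedSpace.exp_eq_tsum ℂ]

lemma mulVec_le {n : ℕ} (A : Matrix (Fin n) (Fin n) ℂ) (c : ℝ) (h : ‖A‖ ≤ c)
    (x : EuclideanSpace ℂ (Fin n)) : ‖Matrix.toEuclideanLin A x‖ ≤ c * ‖x‖ :=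
  (A.l2_opNorm_mulVec x).trans (by gcongr)

lemma mexp_facts {n : ℕ} (P : Matrix (Fin n) (Fin n) ℂ) (hP : opNorm P ≤ 1)
    (lam : ℝ) (h0 : 0 < lam) (h1 : lam ≤ 1 / 2 ^ 6) :
    ∃ F : Matrix (Fin n) (Fin n) ℂ, F * mexp ((lam : ℂ) • P) = 1 ∧
      mexp ((lam : ℂ) • P) * F = 1 ∧
      (∀ x, ‖Matrix.toEuclideanLin (mexp ((lam : ℂ) • P) - 1) x‖ ≤ (65 / 64 * lam) * ‖x‖) ∧
      (∀ x, ‖Matrix.toEuclideanLin (F - 1) x‖ ≤ (65 / 64 * lam) * ‖x‖) := by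
  have hP' : ‖P‖ ≤ 1 := hP
  set A := (lam : ℂ) • P with hA
  have hAn : ‖A‖ ≤ lam := by
    rw [hA, norm_smul, Complex.norm_real, Real.norm_of_nonneg h0.le]
    nlinarith
  have key : ∀ B : Matrix (Fin n) (Fin n) ℂ, ‖B‖ ≤ lam → ‖NormedSpace.exp B - 1‖ ≤ 65 / 64 * lam := by
    intro B hB
    have a1 := exp_sub_one_norm B
    have a2 : Real.exp ‖B‖ ≤ Real.exp lam := Real.exp_le_exp.mpr hB
    have a3 := Real.abs_exp_sub_one_sub_id_le (x := lam) (by rw [abs_of_pos h0]; linarith)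
    have a4 := (abs_le.mp a3).2
    nlinarith
  refine ⟨NormedSpace.exp (-A), ?_, ?_, ?_, ?_⟩
  · rw [mexp_eq, ← Matrix.exp_add_of_commute _ _ (Commute.neg_left (Commute.refl A))]; simp
  · rw [mexp_eq, ← Matrix.exp_add_of_commute _ _ (Commute.neg_right (Commute.refl A))]; simp
  · intro x
    rw [mexp_eq]
    exact mulVec_le _ _ (key A hAn) x
  · exact fun x => mulVec_le _ _ (key (-A) (by rwa [norm_neg])) x

end

lemma proj_step {H : Type*} [NormedAddCommGroup H] [InnerProductSpace ℂ H] [FiniteDimensional ℂ H]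
    (e : H → H) (y s : H) (K : Submodule ℂ H) (d : ℝ)
    (horth : ∀ p ∈ K, inner ℂ (e p) y = 0) (h1 : ∀ p, ‖e p - p‖ ≤ d * ‖p‖)
    (h2 : ‖s - y‖ ≤ d * ‖y‖) :
    ∃ r ∈ K, ‖y - (s - r)‖ ^ 2 ≤ 2 * d ^ 2 * ‖y‖ ^ 2 := by
  refine ⟨K.starProjection s, K.starProjection_apply_mem s, ?_⟩
  set p := K.starProjection y with hp
  have hpK : p ∈ K := K.starProjection_apply_mem y
  have e1 : y - (s - K.starProjection s) = p + ((y - s) - K.starProjection (y - s)) := by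
    rw [map_sub]; abel
  have o1 : inner ℂ p ((y - s) - K.starProjection (y - s)) = 0 :=
    (K.sub_starProjection_mem_orthogonal (y - s)) p hpK
  have n1 : ‖p + ((y - s) - K.starProjection (y - s))‖ ^ 2 =
      ‖p‖ ^ 2 + ‖(y - s) - K.starProjection (y - s)‖ ^ 2 := by
    have := norm_add_sq_eq_norm_sq_add_norm_sq_of_inner_eq_zero _ _ o1
    nlinarith
  have o2 : inner ℂ (K.starProjection (y - s)) ((y - s) - K.starProjection (y - s)) = 0 :=
    (K.sub_starProjection_mem_orthogonal (y - s)) _ (K.starProjection_apply_mem _)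
  have n2 : ‖(y - s) - K.starProjection (y - s)‖ ^ 2 ≤ ‖y - s‖ ^ 2 := by
    have := norm_add_sq_eq_norm_sq_add_norm_sq_of_inner_eq_zero _ _ o2
    rw [add_sub_cancel] at this
    nlinarith [norm_nonneg (K.starProjection (y - s))]
  have o3 : inner ℂ p (y - p) = 0 := (K.sub_starProjection_mem_orthogonal y) p hpK
  have n3 : ‖p‖ ^ 2 ≤ (d * ‖p‖) * ‖y‖ := by
    have a : inner ℂ p y = inner ℂ p p := by
      rw [inner_sub_right] at o3; exact sub_eq_zero.mp o3
    have b : inner ℂ p p = - inner ℂ (e p - p) y := by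
      rw [inner_sub_left, horth p hpK, ← a]; ring
    have c : ‖(inner ℂ p p : ℂ)‖ = ‖p‖ ^ 2 := by
      rw [inner_self_eq_norm_sq_to_K]; simp
    rw [← c, b, norm_neg]
    exact (norm_inner_le_norm _ _).trans (by gcongr; exact h1 p)
  have n4 : ‖p‖ ≤ d * ‖y‖ := by
    rcases (norm_nonneg p).eq_or_lt with h | h
    · rw [← h]; exact (norm_nonneg _).trans h2
    · nlinarith
  have n5 : ‖p‖ ^ 2 ≤ (d * ‖y‖) ^ 2 := by gcongr
  rw [norm_sub_rev] at h2
  have n6 : ‖y - s‖ ^ 2 ≤ (d * ‖y‖) ^ 2 := by gcongr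
  rw [e1, n1]
  nlinarith

/-- comparison of unit vectors -/
lemma top_compare_unit (k : ℕ) {L : ℕ} (u a : Fin L → ℂ) (hu : sqNorm u = 1) (ha : sqNorm a = 1)
    (t q : ℝ) (hq : 0 ≤ q) (h : sqNorm (u - (t : ℂ) • a) ≤ q ^ 2) : topSq k u ≤ topSq k a + q := by
  set r : ℝ := ∑ i, (u i * star (a i)).re with hr
  have ex : ∀ c : ℝ, sqNorm (u - (c : ℂ) • a) = 1 - 2 * c * r + c ^ 2 := by
    intro c
    have : sqNorm (u - (c : ℂ) • a) = sqNorm u - 2 * c * r + c ^ 2 * sqNorm a := by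
      unfold sqNorm
      rw [hr, Finset.mul_sum, Finset.mul_sum, ← Finset.sum_sub_distrib, ← Finset.sum_add_distrib]
      refine Finset.sum_congr rfl fun i _ => ?_
      simp only [Complex.sq_norm, Complex.normSq_apply, Pi.sub_apply, Pi.smul_apply, smul_eq_mul,
        Complex.sub_re, Complex.sub_im, Complex.mul_re, Complex.mul_im, Complex.ofReal_re,
        Complex.ofReal_im, Complex.star_def, Complex.conj_re, Complex.conj_im]
      ring
    rw [this, hu, ha]; ring
  have e1 := ex 1
  have e2 := ex (-1)
  have e3 := ex t
  have hd : 2 * (topSq k u - topSq k a) = ∑ i : Fin L, (if (i : ℕ) < k then (1 : ℝ) else -1) *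
      (‖u i‖ ^ 2 - ‖a i‖ ^ 2) := by
    have b1 := top_add_bot k u
    have b2 := top_add_bot k a
    have : ∑ i : Fin L, (if (i : ℕ) < k then (1 : ℝ) else -1) *
      (‖u i‖ ^ 2 - ‖a i‖ ^ 2) = (topSq k u - topSq k a) - (botSq k u - botSq k a) := by
      unfold topSq botSq
      simp only [← Finset.sum_sub_distrib]
      refine Finset.sum_congr rfl fun i _ => ?_
      split_ifs <;> ring
    rw [this]; linarith
  have hle : 2 * (topSq k u - topSq k a) ≤
      ∑ i : Fin L, ‖(u - ((1 : ℝ) : ℂ) • a) i‖ * ‖(u - ((-1 : ℝ) : ℂ) • a) i‖ := by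
    rw [hd]
    refine Finset.sum_le_sum fun i _ => ?_
    have key : |‖u i‖ ^ 2 - ‖a i‖ ^ 2| ≤ ‖u i - a i‖ * ‖u i + a i‖ := by
      have : ‖u i‖ ^ 2 - ‖a i‖ ^ 2 = ((u i - a i) * star (u i + a i)).re := by
        simp only [Complex.sq_norm, Complex.normSq_apply, Complex.sub_re, Complex.sub_im,
          Complex.mul_re, Complex.star_def, Complex.conj_re, Complex.conj_im, Complex.add_re,
          Complex.add_im]
        ring
      rw [this]
      refine (Complex.abs_re_le_norm _).trans ?_
      rw [norm_mul, norm_star]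
    have k1 := abs_le.mp key
    simp only [Pi.sub_apply, Pi.neg_apply, Complex.ofReal_one, one_smul, Complex.ofReal_neg,
      neg_smul, sub_neg_eq_add]
    split_ifs <;> linarith
  have cs := Finset.sum_mul_sq_le_sq_mul_sq Finset.univ
    (fun i => ‖(u - ((1 : ℝ) : ℂ) • a) i‖) (fun i => ‖(u - ((-1 : ℝ) : ℂ) • a) i‖)
  change _ ≤ sqNorm (u - ((1 : ℝ) : ℂ) • a) * sqNorm (u - ((-1 : ℝ) : ℂ) • a) at cs
  rw [e1, e2] at cs
  set S := ∑ i : Fin L, ‖(u - ((1 : ℝ) : ℂ) • a) i‖ * ‖(u - ((-1 : ℝ) : ℂ) • a) i‖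
  have : S ^ 2 ≤ (2 * q) ^ 2 := by nlinarith [sq_nonneg (t - r)]
  have := abs_le_of_sq_le_sq' this (by positivity)
  linarith [this.2]

lemma top_compare (k : ℕ) {L : ℕ} (y a : Fin L → ℂ) (hy : 0 < sqNorm y) (ha : 0 < sqNorm a)
    (q : ℝ) (hq : 0 ≤ q) (h : sqNorm (y - a) ≤ q ^ 2 * sqNorm y) :
    topSq k y / sqNorm y ≤ topSq k a / sqNorm a + q := by
  have sc : ∀ x : Fin L → ℂ, 0 < sqNorm x →
      ‖(((Real.sqrt (sqNorm x))⁻¹ : ℝ) : ℂ)‖ ^ 2 = (sqNorm x)⁻¹ := by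
    intro x hx
    rw [Complex.norm_real, Real.norm_eq_abs, sq_abs, inv_pow, Real.sq_sqrt hx.le]
  have := top_compare_unit k ((((Real.sqrt (sqNorm y))⁻¹ : ℝ) : ℂ) • y)
    ((((Real.sqrt (sqNorm a))⁻¹ : ℝ) : ℂ) • a)
    (by rw [sqNorm_smul, sc y hy, inv_mul_cancel₀ hy.ne'])
    (by rw [sqNorm_smul, sc a ha, inv_mul_cancel₀ ha.ne'])
    ((Real.sqrt (sqNorm y))⁻¹ * Real.sqrt (sqNorm a)) q hq (by
      have : (((Real.sqrt (sqNorm y))⁻¹ : ℝ) : ℂ) • y -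
          ((((Real.sqrt (sqNorm y))⁻¹ * Real.sqrt (sqNorm a)) : ℝ) : ℂ) •
            (((Real.sqrt (sqNorm a))⁻¹ : ℝ) : ℂ) • a
          = (((Real.sqrt (sqNorm y))⁻¹ : ℝ) : ℂ) • (y - a) := by
        rw [smul_smul, ← Complex.ofReal_mul, mul_assoc,
          mul_inv_cancel₀ (Real.sqrt_pos.mpr ha).ne', mul_one, smul_sub]
      rw [this, sqNorm_smul, sc y hy]
      calc (sqNorm y)⁻¹ * sqNorm (y - a) ≤ (sqNorm y)⁻¹ * (q ^ 2 * sqNorm y) := by gcongr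
        _ = q ^ 2 := by field_simp)
  rw [topSq_smul, topSq_smul, sc y hy, sc a ha] at this
  rw [div_eq_inv_mul, div_eq_inv_mul]
  exact this

lemma R_mono (κ : ℕ → ℝ) (L k : ℕ) (hk : k < L)
    (hκpos : ∀ i, 1 ≤ i → i ≤ L → 0 < κ i)
    (hκmono : ∀ i j, 1 ≤ i → i ≤ j → j ≤ L → κ j ≤ κ i) (g : Fin L → ℂ) :
    topSq k ((Rmat κ L).mulVec g) * sqNorm g ≤ topSq k g * sqNorm ((Rmat κ L).mulVec g) := by
  have ent : ∀ i : Fin L, ‖(Rmat κ L).mulVec g i‖ ^ 2 = κ (L - i) ^ 2 * ‖g i‖ ^ 2 := by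
    intro i
    rw [Rmat, Matrix.mulVec_diagonal, norm_mul, mul_pow, Complex.norm_real, Real.norm_eq_abs, sq_abs]
  obtain ⟨c, hc⟩ : ∃ c, c = κ (L - k) ^ 2 := ⟨_, rfl⟩
  have h1 : topSq k ((Rmat κ L).mulVec g) ≤ c * topSq k g := by
    unfold topSq
    rw [Finset.mul_sum]
    refine Finset.sum_le_sum fun i _ => ?_
    split_ifs with h
    · rw [ent, hc]
      have := hκpos (L - i) (by omega) (by omega)
      have := hκmono (L - k) (L - i) (by omega) (by omega) (by omega)
      gcongr
    · simp
  have h2 : c * botSq k g ≤ botSq k ((Rmat κ L).mulVec g) := by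
    unfold botSq
    rw [Finset.mul_sum]
    refine Finset.sum_le_sum fun i _ => ?_
    split_ifs with h
    · simp
    · rw [ent, hc]
      have := hκpos (L - k) (by omega) (by omega)
      have := hκmono (L - i) (L - k) (by omega) (by omega) (by omega)
      gcongr
  rw [← top_add_bot k g, ← top_add_bot k ((Rmat κ L).mulVec g)]
  have a := topSq_nonneg k g
  have b := botSq_nonneg k g
  nlinarith [mul_le_mul_of_nonneg_right h1 b, mul_le_mul_of_nonneg_left h2 a]

/-- trace bound -/
lemma top_W (k L : ℕ) (W : Matrix (Fin L) (Fin L) ℂ) (hW2 : W * W = W) (hWs : Wᴴ = W)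
    (w : Fin L → ℂ) (hw : W.mulVec w = w) :
    topSq k w ≤ (∑ i : Fin L, if (i : ℕ) < k then (W i i).re else 0) * sqNorm w := by
  unfold topSq
  rw [Finset.sum_mul]
  refine Finset.sum_le_sum fun i _ => ?_
  split_ifs with h
  · have h1 : (W i i).re = ∑ j, ‖W i j‖ ^ 2 := by
      have : (W * Wᴴ) i i = W i i := by rw [hWs, hW2]
      rw [← this, Matrix.mul_apply, Complex.re_sum]
      refine Finset.sum_congr rfl fun j _ => ?_
      rw [Matrix.conjTranspose_apply, Complex.star_def, Complex.mul_conj, Complex.ofReal_re,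
        Complex.normSq_eq_norm_sq]
    have h2 : ‖w i‖ ≤ ∑ j, ‖W i j‖ * ‖w j‖ := by
      conv_lhs => rw [← hw]
      rw [Matrix.mulVec, dotProduct]
      refine (norm_sum_le _ _).trans (le_of_eq ?_)
      simp
    calc ‖w i‖ ^ 2 ≤ (∑ j, ‖W i j‖ * ‖w j‖) ^ 2 := by gcongr
      _ ≤ _ := Finset.sum_mul_sq_le_sq_mul_sq _ _ _
      _ = _ := by rw [h1]; rfl
  · simp

lemma trace_bound (L D k : ℕ) (hk : k ≤ L - D) (W : Matrix (Fin L) (Fin L) ℂ) (hW2 : W * W = W)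
    (hWs : Wᴴ = W) : (∑ i : Fin L, if (i : ℕ) < k then (W i i).re else 0) ≤
      ((basisFrame L (L - D) 0)ᴴ * W * basisFrame L (L - D) 0).trace.re := by
  have hpos : ∀ i, 0 ≤ (W i i).re := by
    intro i
    have : (W * Wᴴ) i i = W i i := by rw [hWs, hW2]
    rw [← this, Matrix.mul_apply, Complex.re_sum]
    refine Finset.sum_nonneg fun j _ => ?_
    rw [Matrix.conjTranspose_apply, Complex.star_def, Complex.mul_conj, Complex.ofReal_re]
    exact Complex.normSq_nonneg _
  have e : ((basisFrame L (L - D) 0)ᴴ * W * basisFrame L (L - D) 0).trace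
      = ∑ i : Fin L, if (i : ℕ) < L - D then W i i else 0 := by
    have hB : basisFrame L (L - D) 0 * (basisFrame L (L - D) 0)ᴴ
        = Matrix.diagonal fun i : Fin L => if (i : ℕ) < L - D then (1 : ℂ) else 0 := by
      ext i j
      rw [Matrix.mul_apply, Matrix.diagonal_apply]
      simp only [basisFrame, Matrix.conjTranspose_apply, Matrix.of_apply, zero_add]
      by_cases hi : (i : ℕ) < L - D
      · rw [Finset.sum_eq_single (⟨i, hi⟩ : Fin (L - D))]
        · by_cases hij : i = j
          · subst hij; simp [hi]
          · have : (j : ℕ) ≠ i := fun h => hij (Fin.ext h.symm)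
            simp [hij, this]
        · intro b _ hb
          have : (i : ℕ) ≠ b := fun h => hb (Fin.ext h.symm)
          simp [this]
        · simp
      · rw [Finset.sum_eq_zero]
        · simp [hi]
        · intro b _
          have : (i : ℕ) ≠ b := by have := b.2; omega
          simp [this]
    rw [Matrix.mul_assoc, Matrix.trace_mul_comm, Matrix.mul_assoc, hB, Matrix.trace]
    refine Finset.sum_congr rfl fun i _ => ?_
    rw [Matrix.diag_apply, Matrix.mul_diagonal]
    simp
  rw [e, Complex.re_sum]
  refine Finset.sum_le_sum fun i _ => ?_
  by_cases h : (i : ℕ) < k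
  · have : (i : ℕ) < L - D := by omega
    simp [h, this]
  · rw [if_neg h]
    split_ifs
    · exact hpos i
    · simp

lemma top_sub (k L : ℕ) (v w : Fin L → ℂ) (t : ℝ) (ht : 0 ≤ t) (hw : topSq k w ≤ t * sqNorm w) :
    topSq k (v - w) ≤ (topSq k v + t) * (1 + sqNorm w) := by
  have e1 : ∀ x : Fin L → ℂ, topSq k x = ∑ i ∈ Finset.univ.filter (fun i : Fin L => (i : ℕ) < k), ‖x i‖ ^ 2 :=
    fun x => by rw [Finset.sum_filter]; rfl
  have cs := Finset.sum_mul_sq_le_sq_mul_sq (Finset.univ.filter (fun i : Fin L => (i : ℕ) < k))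
    (fun i => ‖v i‖) (fun i => ‖w i‖)
  rw [← e1, ← e1] at cs
  have h1 : topSq k (v - w) ≤ topSq k v + topSq k w + 2 *
      ∑ i ∈ Finset.univ.filter (fun i : Fin L => (i : ℕ) < k), ‖v i‖ * ‖w i‖ := by
    rw [e1, e1, e1, Finset.mul_sum, ← Finset.sum_add_distrib, ← Finset.sum_add_distrib]
    refine Finset.sum_le_sum fun i _ => ?_
    have := norm_sub_le (v i) (w i)
    have : ‖(v - w) i‖ ^ 2 ≤ (‖v i‖ + ‖w i‖) ^ 2 := by gcongr; exact this
    nlinarith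
  set S := ∑ i ∈ Finset.univ.filter (fun i : Fin L => (i : ℕ) < k), ‖v i‖ * ‖w i‖
  have a := topSq_nonneg k v
  have b := sqNorm_nonneg w
  have cs2 : S ^ 2 ≤ topSq k v * (t * sqNorm w) := cs.trans (by gcongr)
  have h2 : 2 * S ≤ t + topSq k v * sqNorm w := by
    have : (2 * S) ^ 2 ≤ (t + topSq k v * sqNorm w) ^ 2 := by
      nlinarith [sq_nonneg (t - topSq k v * sqNorm w)]
    exact (abs_le_of_sq_le_sq' this (by positivity)).2
  nlinarith

lemma pyth (L : ℕ) (W : Matrix (Fin L) (Fin L) ℂ) (hWs : Wᴴ = W) (v w : Fin L → ℂ)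
    (hv : sqNorm v = 1) (hWv : W.mulVec v = 0) (hw : W.mulVec w = w) :
    sqNorm (v - w) = 1 + sqNorm w := by
  have : star w ⬝ᵥ v = 0 := by
    rw [← hw, Matrix.star_mulVec, ← Matrix.dotProduct_mulVec, hWs, hWv, dotProduct_zero]
  have h0 : ∑ i, (v i * star (w i)).re = 0 := by
    rw [← Complex.re_sum]
    have h : ∑ i, v i * star (w i) = star w ⬝ᵥ v :=
      Finset.sum_congr rfl fun i _ => by simp [mul_comm]
    rw [h, this]; rfl
  have : sqNorm (v - w) = sqNorm v - 2 * ∑ i, (v i * star (w i)).re + sqNorm w := by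
    unfold sqNorm
    rw [Finset.mul_sum, ← Finset.sum_sub_distrib, ← Finset.sum_add_distrib]
    refine Finset.sum_congr rfl fun i _ => ?_
    simp only [Complex.sq_norm, Complex.normSq_apply, Pi.sub_apply,
      Complex.sub_re, Complex.sub_im, Complex.mul_re, Complex.star_def, Complex.conj_re, Complex.conj_im]
    ring
  rw [this, h0, hv]; ring

open scoped ComplexOrder in
lemma gr_facts (L : ℕ) (T T' W : Matrix (Fin L) (Fin L) ℂ) (hT : T' * T = 1) (hW2 : W * W = W)
    (hWs : Wᴴ = W) (v : Fin L → ℂ) :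
    ∃ w, W.mulVec w = w ∧ ((1 - grAct T W) * T).mulVec v = T.mulVec (v - w) ∧
      (T * W)ᴴ.mulVec (((1 - grAct T W) * T).mulVec v) = 0 := by
  set M := W * Tᴴ * T * W + (1 - W) with hM
  have hWM : W * M = W * Tᴴ * T * W := by
    rw [hM, mul_add, mul_sub, mul_one, hW2, sub_self, add_zero]
    simp only [← mul_assoc, hW2]
  have hMu : IsUnit M := by
    rw [← Matrix.mulVec_injective_iff_isUnit]
    intro x x' hxx
    rw [← sub_eq_zero]
    have hx : M.mulVec (x - x') = 0 := by rw [Matrix.mulVec_sub]; exact sub_eq_zero.mpr hxx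
    set z := x - x'
    have h1 : ((T * W)ᴴ * (T * W)).mulVec z = 0 := by
      have : (T * W)ᴴ * (T * W) = W * M := by
        rw [hWM, Matrix.conjTranspose_mul, hWs]; simp only [mul_assoc]
      rw [this, ← Matrix.mulVec_mulVec, hx, Matrix.mulVec_zero]
    have h2 : (T * W).mulVec z = 0 := by
      rwa [Matrix.conjTranspose_mul_self_mulVec_eq_zero] at h1
    have h3 : W.mulVec z = 0 := by
      have : T'.mulVec ((T * W).mulVec z) = 0 := by rw [h2, Matrix.mulVec_zero]
      rwa [Matrix.mulVec_mulVec, ← mul_assoc, hT, one_mul] at this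
    rw [hM, Matrix.add_mulVec, Matrix.sub_mulVec, ← Matrix.mulVec_mulVec, h3, Matrix.mulVec_zero,
      Matrix.one_mulVec] at hx
    simpa using hx
  have hMM : M * M⁻¹ = 1 := Matrix.mul_nonsing_inv _ ((Matrix.isUnit_iff_isUnit_det _).mp hMu)
  refine ⟨W.mulVec ((M⁻¹ * (W * Tᴴ) * T).mulVec v), ?_, ?_, ?_⟩
  · rw [Matrix.mulVec_mulVec, hW2]
  · rw [Matrix.mulVec_sub, Matrix.mulVec_mulVec, Matrix.mulVec_mulVec, ← Matrix.sub_mulVec]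
    congr 1
    rw [grAct, ← hM, sub_mul, one_mul]
    simp only [mul_assoc]
  · rw [Matrix.mulVec_mulVec]
    have : (T * W)ᴴ * ((1 - grAct T W) * T) = 0 := by
      have h : (T * W)ᴴ * grAct T W = (T * W)ᴴ := by
        rw [grAct, ← hM, Matrix.conjTranspose_mul, hWs]
        calc W * Tᴴ * (T * W * M⁻¹ * (W * Tᴴ)) = (W * Tᴴ * T * W) * M⁻¹ * (W * Tᴴ) := by
              simp only [mul_assoc]
          _ = W * (M * M⁻¹) * (W * Tᴴ) := by rw [← hWM]; simp only [mul_assoc]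
          _ = W * Tᴴ := by rw [hMM, mul_one, ← mul_assoc, hW2]
      rw [← mul_assoc, mul_sub, h, mul_one, sub_self, zero_mul]
    rw [this, Matrix.zero_mulVec]

lemma main_top (L D k w : ℕ) (hk : k ≤ L - D) (hkL : k < L)
    (lam : ℝ) (hlam0 : 0 < lam) (hlam : lam ≤ 1 / 2 ^ 6)
    (κ : ℕ → ℝ)
    (hκpos : ∀ i, 1 ≤ i → i ≤ L → 0 < κ i)
    (hκmono : ∀ i j, 1 ≤ i → i ≤ j → j ≤ L → κ j ≤ κ i)
    (P : Matrix (Fin L) (Fin L) ℂ) (hP : opNorm P ≤ 1)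
    (W : Matrix (Fin L) (Fin L) ℂ) (hW : IsProjOfRank w W)
    (v : Fin L → ℂ) (hv : sqNorm v = 1) (hWv : W.mulVec v = 0)
    (hover : ((basisFrame L (L - D) 0)ᴴ * W * basisFrame L (L - D) 0).trace.re
      ≤ 2⁻¹ ^ 3 * lam) :
    sqNorm (circAct ((1 - grAct (mexp ((lam : ℂ) • P) * Rmat κ L) W)
        * (mexp ((lam : ℂ) • P) * Rmat κ L)) v) = 1 ∧
    topSq k (circAct ((1 - grAct (mexp ((lam : ℂ) • P) * Rmat κ L) W)
        * (mexp ((lam : ℂ) • P) * Rmat κ L)) v) ≤ topSq k v + 7 / 4 * lam := by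
  obtain ⟨hW2, hWs, -⟩ := hW
  obtain ⟨F, hF1, hF2, he, hF⟩ := mexp_facts P hP lam hlam0 hlam
  set e := mexp ((lam : ℂ) • P)
  set R := Rmat κ L with hR
  obtain ⟨R', hR'⟩ : ∃ R', R' * R = 1 := by
    refine ⟨Matrix.diagonal fun i : Fin L => (κ (L - (i : ℕ)) : ℂ)⁻¹, ?_⟩
    rw [hR, Rmat, Matrix.diagonal_mul_diagonal, ← Matrix.diagonal_one]
    congr 1
    funext i
    have := hκpos (L - i) (by omega) (by omega)
    exact inv_mul_cancel₀ (by exact_mod_cast this.ne')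
  have hT : (R' * F) * (e * R) = 1 := by
    rw [mul_assoc, ← mul_assoc F, hF1, one_mul, hR']
  obtain ⟨w0, hw0, hy, horth⟩ := gr_facts L (e * R) (R' * F) W hT hW2 hWs v
  set S := (1 - grAct (e * R) W) * (e * R)
  set y := S.mulVec v with hydef
  have nz : ∀ x : Fin L → ℂ, W.mulVec x = x → 0 < sqNorm (v - x) := by
    intro x hx
    rw [pyth L W hWs v x hv hWv hx]
    linarith [sqNorm_nonneg x]
  have npos : ∀ x : Fin L → ℂ, x ≠ 0 → 0 < sqNorm x := by
    intro x hx
    rw [sqNorm_eq]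
    have : (WithLp.toLp 2 x : EuclideanSpace ℂ (Fin L)) ≠ 0 := by
      simpa using hx
    positivity
  have sq0 : sqNorm (0 : Fin L → ℂ) = 0 := by simp [sqNorm]
  have hypos : 0 < sqNorm y := by
    apply npos
    intro h0
    have := nz w0 hw0
    have h : v - w0 = 0 := by
      have h' : (R' * F).mulVec y = v - w0 := by
        rw [hy, Matrix.mulVec_mulVec, hT, Matrix.one_mulVec]
      rw [← h', h0, Matrix.mulVec_zero]
    rw [h, sq0] at this
    exact lt_irrefl _ this
  -- the intermediate vector
  obtain ⟨r, hrK, hr⟩ := proj_step (H := EuclideanSpace ℂ (Fin L))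
    (fun x => Matrix.toEuclideanLin e x) (WithLp.toLp 2 y) (WithLp.toLp 2 (R.mulVec (v - w0)))
    (LinearMap.range (Matrix.toEuclideanLin (R * W))) (65 / 64 * lam)
    (by
      rintro _ ⟨p, rfl⟩
      have h1 : Matrix.toEuclideanLin e (Matrix.toEuclideanLin (R * W) p)
          = WithLp.toLp 2 ((e * R * W).mulVec p.ofLp) := by
        simp [Matrix.toLpLin_apply, Matrix.mulVec_mulVec, mul_assoc]
      rw [h1, EuclideanSpace.inner_toLp_toLp, Matrix.star_mulVec, dotProduct_comm,
        ← Matrix.dotProduct_mulVec, horth, dotProduct_zero])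
    (by
      intro p
      have := he p
      simpa [map_sub, Matrix.toLpLin_one] using this)
    (by
      have := hF (WithLp.toLp 2 y)
      have h1 : Matrix.toEuclideanLin (F - 1) (WithLp.toLp 2 y)
          = WithLp.toLp 2 (R.mulVec (v - w0)) - WithLp.toLp 2 y := by
        have : F.mulVec y = R.mulVec (v - w0) := by
          rw [hy, Matrix.mulVec_mulVec, ← mul_assoc, hF1, one_mul]
        rw [Matrix.toLpLin_toLp, Matrix.toLin'_apply, Matrix.sub_mulVec, this, Matrix.one_mulVec]
        rfl
      rwa [h1] at this)
  obtain ⟨p, rfl⟩ := hrK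
  set w1 := w0 + W.mulVec p.ofLp with hw1d
  have hw1 : W.mulVec w1 = w1 := by
    rw [hw1d, Matrix.mulVec_add, hw0, Matrix.mulVec_mulVec, hW2]
  have hr2 : sqNorm (y - R.mulVec (v - w1)) ≤ (13 / 8 * lam) ^ 2 * sqNorm y := by
    have h1 : (WithLp.toLp 2 (y - R.mulVec (v - w1)) : EuclideanSpace ℂ (Fin L)) =
        WithLp.toLp 2 y - (WithLp.toLp 2 (R.mulVec (v - w0)) - Matrix.toEuclideanLin (R * W) p) := by
      have : R.mulVec (v - w1) = R.mulVec (v - w0) - (R * W).mulVec p.ofLp := by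
        rw [← Matrix.mulVec_mulVec, ← Matrix.mulVec_sub, hw1d, sub_add_eq_sub_sub]
      rw [this]
      rfl
    rw [sqNorm_eq, sqNorm_eq, h1]
    refine hr.trans ?_
    gcongr
    nlinarith
  have hg := nz w1 hw1
  have hapos : 0 < sqNorm (R.mulVec (v - w1)) := by
    apply npos
    intro h0
    have h : v - w1 = 0 := by
      have h' : R'.mulVec (R.mulVec (v - w1)) = v - w1 := by
        rw [Matrix.mulVec_mulVec, hR', Matrix.one_mulVec]
      rw [← h', h0, Matrix.mulVec_zero]
    rw [h, sq0] at hg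
    exact lt_irrefl _ hg
  have c1 := top_compare k y (R.mulVec (v - w1)) hypos hapos (13 / 8 * lam) (by positivity) hr2
  have c2 := R_mono κ L k hkL hκpos hκmono (v - w1)
  rw [← hR] at c2
  have c3 : topSq k (v - w1) ≤ (topSq k v + 2⁻¹ ^ 3 * lam) * sqNorm (v - w1) := by
    rw [pyth L W hWs v w1 hv hWv hw1]
    refine top_sub k L v w1 _ (by positivity) ?_
    refine (top_W k L W hW2 hWs w1 hw1).trans ?_
    have := sqNorm_nonneg w1
    gcongr
    exact (trace_bound L D k hk W hW2 hWs).trans hover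
  have c4 : topSq k (R.mulVec (v - w1)) / sqNorm (R.mulVec (v - w1)) ≤
      topSq k v + 2⁻¹ ^ 3 * lam := by
    rw [div_le_iff₀ hapos]
    have : topSq k (R.mulVec (v - w1)) * sqNorm (v - w1) ≤
        ((topSq k v + 2⁻¹ ^ 3 * lam) * sqNorm (R.mulVec (v - w1))) * sqNorm (v - w1) := by
      nlinarith
    exact le_of_mul_le_mul_right this hg
  have sc : ‖((vNorm y : ℂ))⁻¹‖ ^ 2 = (sqNorm y)⁻¹ := by
    rw [norm_inv, Complex.norm_real, Real.norm_eq_abs, inv_pow, sq_abs, vNorm,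
      Real.sq_sqrt hypos.le]
  constructor
  · rw [circAct, ← hydef, sqNorm_smul, sc, inv_mul_cancel₀ hypos.ne']
  · rw [circAct, ← hydef, topSq_smul, sc, ← div_eq_inv_mul]
    linarith

/-- deterministic bounds on one step of the full random action, in the
overwhelming region: if `tr[(ζ̂^⊥)*Wζ̂^⊥] ≤ 2^{-3}λ` then
`‖𝔵((((e^{λP}ℛ)·W)^⊥(e^{λP}ℛ))∘v)‖² ≤ ‖𝔵(v)‖² + (7/4)λ` and
`‖𝔷((((e^{λP}ℛ)·W)^⊥(e^{λP}ℛ))∘v)‖² ≥ ‖𝔷(v)‖² − (7/4)λ`. -/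
theorem statement11 (L D E w : ℕ) (hD : 1 ≤ D) (hDE : D < E) (hE : E ≤ L)
    (lam : ℝ) (hlam0 : 0 < lam) (hlam : lam ≤ 1 / 2 ^ 6)
    (κ : ℕ → ℝ)
    (hκpos : ∀ i, 1 ≤ i → i ≤ L → 0 < κ i)
    (hκmono : ∀ i j, 1 ≤ i → i ≤ j → j ≤ L → κ j ≤ κ i)
    (P : Matrix (Fin L) (Fin L) ℂ) (hP : opNorm P ≤ 1)
    (W : Matrix (Fin L) (Fin L) ℂ) (hW : IsProjOfRank w W)
    (v : Fin L → ℂ) (hv : sqNorm v = 1) (hWv : W.mulVec v = 0)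
    (hover : ((basisFrame L (L - D) 0)ᴴ * W * basisFrame L (L - D) 0).trace.re
      ≤ 2⁻¹ ^ 3 * lam) :
    xSq E (circAct ((1 - grAct (mexp ((lam : ℂ) • P) * Rmat κ L) W)
        * (mexp ((lam : ℂ) • P) * Rmat κ L)) v) ≤ xSq E v + 7 / 4 * lam ∧
    zSq D (circAct ((1 - grAct (mexp ((lam : ℂ) • P) * Rmat κ L) W)
        * (mexp ((lam : ℂ) • P) * Rmat κ L)) v) ≥ zSq D v - 7 / 4 * lam := by
  have key := fun k hk hkL => main_top L D k w hk hkL lam hlam0 hlam κ hκpos hκmono P hP W hW v hv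
    hWv hover
  refine ⟨(key (L - E) (by omega) (by omega)).2, ?_⟩
  obtain ⟨h1, h2⟩ := key (L - D) le_rfl (by omega)
  have hz : ∀ x : Fin L → ℂ, zSq D x = sqNorm x - topSq (L - D) x := by
    intro x
    rw [← top_add_bot (L - D) x, add_sub_cancel_left]
    unfold zSq botSq
    refine Finset.sum_congr rfl fun i _ => ?_
    by_cases h : (i : ℕ) < L - D
    · rw [if_neg (by omega), if_pos h]
    · rw [if_pos (by omega), if_neg h]
  rw [hz, hz, h1, hv]
  linarith

end
end

section
/- Let 0 < λ ≤ 2^{-6}, let 1 ≤ D < E ≤ L with τ := η(D,E) > 0, let P ∈ ℂ^{L×L} with ‖P‖ ≤ 1, let W ∈ 𝔾_{L,w} and let v ∈ ℂ^L be a unit vector with Wv = 0. Assume tr[(ζ̂^⊥)*Wζ̂^⊥] ≤ 2^{-3}λ and ‖𝔵(v)‖²·‖𝔷(v)‖² ≥ 2λ/τ. Then ‖𝔵((((e^{λP}ℛ)·W)^⊥(e^{λP}ℛ))∘v)‖² ≤ ‖𝔵(v)‖² − 2^{-2}λ and ‖𝔷((((e^{λP}ℛ)·W)^⊥(e^{λP}ℛ))∘v)‖²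 ≥ ‖𝔷(v)‖² + 2^{-2}λ. -/
open Matrix BigOperators

noncomputable section

section MexpBound
open scoped Matrix.Norms.L2Operator

lemma mexp_bound_aux {n : ℕ} (A : Matrix (Fin n) (Fin n) ℂ) :
    ‖mexp A - 1‖ ≤ Real.exp ‖A‖ - 1 := by
  have hs : Summable fun k : ℕ => ((k.factorial : ℂ))⁻¹ • A ^ k :=
    NormedSpace.expSeries_summable' (𝕂 := ℂ) A
  have h1 : mexp A - 1 = ∑' k : ℕ, (((k+1).factorial : ℂ))⁻¹ • A ^ (k+1) := by
    have := hs.tsum_eq_zero_add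
    unfold mexp
    rw [this]; simp
  have hr : HasSum (fun k : ℕ => ((k.factorial : ℝ))⁻¹ * ‖A‖ ^ k) (Real.exp ‖A‖) := by
    rw [Real.exp_eq_exp_ℝ]
    exact NormedSpace.exp_series_hasSum_exp' (𝕂 := ℝ) ‖A‖
  have hr1 : HasSum (fun k : ℕ => (((k+1).factorial : ℝ))⁻¹ * ‖A‖ ^ (k+1)) (Real.exp ‖A‖ - 1) := by
    have := (hasSum_nat_add_iff' (f := fun k : ℕ => ((k.factorial : ℝ))⁻¹ * ‖A‖ ^ k) 1).2 hr
    simpa using this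
  rw [h1]
  refine tsum_of_norm_bounded hr1 fun k => ?_
  rw [norm_smul]
  have : ‖((((k+1).factorial : ℕ) : ℂ))⁻¹‖ = (((k+1).factorial : ℝ))⁻¹ := by
    rw [norm_inv, Complex.norm_natCast]
  rw [this]
  gcongr
  exact norm_pow_le' A (Nat.succ_pos k)

lemma mexp_bound {n : ℕ} (P : Matrix (Fin n) (Fin n) ℂ) (hP : opNorm P ≤ 1)
    (lam : ℝ) (h0 : 0 < lam) (h1 : lam ≤ 1 / 2 ^ 6) (x : Fin n → ℂ) :
    ‖WithLp.toLp 2 ((mexp ((lam : ℂ) • P) - 1) *ᵥ x)‖ ≤ 65 / 64 * lam * ‖WithLp.toLp 2 x‖ := by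
  have hP' : ‖P‖ ≤ 1 := hP
  have hA : ‖(lam : ℂ) • P‖ ≤ lam := by
    rw [norm_smul, Complex.norm_real, Real.norm_of_nonneg h0.le]
    nlinarith
  have hexp : Real.exp ‖(lam : ℂ) • P‖ - 1 ≤ 65 / 64 * lam := by
    have e1 := Real.exp_le_exp.2 hA
    have e2 := Real.abs_exp_sub_one_sub_id_le (x := lam) (by rw [abs_of_pos h0]; norm_num at h1; linarith)
    have e3 := (abs_le.1 e2).2
    norm_num at h1
    nlinarith
  have := l2_opNorm_mulVec (mexp ((lam : ℂ) • P) - 1) (WithLp.toLp 2 x)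
  refine le_trans this ?_
  gcongr
  exact (mexp_bound_aux _).trans hexp

end MexpBound

lemma hilb_aux {V : Type*} [NormedAddCommGroup V] [InnerProductSpace ℂ V] [FiniteDimensional ℂ V]
    (S : Submodule ℂ V) (N : V → V) (p : ℝ) (hp : 0 ≤ p) (hN : ∀ x, ‖N x‖ ≤ p * ‖x‖)
    (u0 q u : V) (hu0 : u0 ∈ Sᗮ) (hq : q ∈ S) (hu : u = (u0 - q) + N (u0 - q))
    (ho : ∀ s ∈ S, inner ℂ (s + N s) u = 0) :
    ‖u - u0‖ ^ 2 ≤ p ^ 2 * ‖u‖ ^ 2 + p ^ 2 * ‖u0 - q‖ ^ 2 := by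
  have hd := S.norm_sq_eq_add_norm_sq_starProjection (u - u0)
  have h0 : S.starProjection u0 = 0 := (Submodule.starProjection_apply_eq_zero_iff S).2 hu0
  have h1 : ‖S.starProjection (u - u0)‖ ≤ p * ‖u‖ := by
    rw [map_sub, h0, sub_zero]
    set s := S.starProjection u with hs
    have hsS : s ∈ S := Submodule.starProjection_apply_mem _ _
    have a1 := ho s hsS
    rw [inner_add_left] at a1
    have a2 : inner ℂ s (u - s) = 0 :=
      (Submodule.mem_orthogonal S _).1 (Submodule.sub_starProjection_mem_orthogonal u) s hsS
    have a3 : inner ℂ s u = (‖s‖ : ℂ) ^ 2 := by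
      rw [inner_sub_right, sub_eq_zero] at a2
      rw [a2]; exact inner_self_eq_norm_sq_to_K s
    have a4 : ‖s‖ ^ 2 ≤ p * ‖s‖ * ‖u‖ := by
      have : ‖inner ℂ s u‖ = ‖s‖ ^ 2 := by rw [a3]; simp
      rw [← this, eq_neg_of_add_eq_zero_left a1, norm_neg]
      refine (norm_inner_le_norm _ _).trans ?_
      gcongr; exact hN s
    by_cases hz : ‖s‖ = 0
    · rw [hz]; positivity
    · have : 0 < ‖s‖ := lt_of_le_of_ne (norm_nonneg _) (Ne.symm hz)
      nlinarith
  have h2 : ‖Sᗮ.starProjection (u - u0)‖ ≤ p * ‖u0 - q‖ := by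
    have e : u - u0 = - q + N (u0 - q) := by rw [hu]; abel
    have hq' : Sᗮ.starProjection (-q) = 0 := by
      rw [Submodule.starProjection_apply_eq_zero_iff]
      exact Submodule.le_orthogonal_orthogonal S (S.neg_mem hq)
    rw [e, map_add, hq', zero_add]
    refine le_trans ?_ (hN _)
    exact Submodule.norm_starProjection_apply_le _ _
  rw [hd]
  have := pow_le_pow_left₀ (norm_nonneg _) h1 2
  have := pow_le_pow_left₀ (norm_nonneg _) h2 2
  nlinarith

lemma planar (A B A0 B0 c : ℝ)  (hc : 0 ≤ c) (hn : 0 < A ^ 2 + B ^ 2) (hn0 : 0 < A0 ^ 2 + B0 ^ 2)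
    (h : (A - A0) ^ 2 + (B - B0) ^ 2 ≤ c ^ 2 * (A ^ 2 + B ^ 2)) :
    |A ^ 2 / (A ^ 2 + B ^ 2) - A0 ^ 2 / (A0 ^ 2 + B0 ^ 2)| ≤ c := by
  apply abs_le_of_sq_le_sq _ hc
  have e : A ^ 2 / (A ^ 2 + B ^ 2) - A0 ^ 2 / (A0 ^ 2 + B0 ^ 2) =
    ((A * B0 - A0 * B) * (A * B0 + A0 * B)) / ((A ^ 2 + B ^ 2) * (A0 ^ 2 + B0 ^ 2)) := by
    field_simp; ring
  rw [e, div_pow, div_le_iff₀ (by positivity), mul_pow]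
  set n := A ^ 2 + B ^ 2
  set n0 := A0 ^ 2 + B0 ^ 2
  have h1 : (A * B0 - A0 * B) ^ 2 ≤ n0 * (c ^ 2 * n) := by
    have : (A * B0 - A0 * B) ^ 2 ≤ n0 * ((A - A0) ^ 2 + (B - B0) ^ 2) := by
      nlinarith [sq_nonneg (A0 * (A - A0) + B0 * (B - B0))]
    exact this.trans (by gcongr)
  have h2 : (A * B0 + A0 * B) ^ 2 ≤ n * n0 := by
    nlinarith [sq_nonneg (A * A0 - B * B0)]
  calc _ ≤ (n0 * (c ^ 2 * n)) * (n * n0) := by gcongr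
    _ = _ := by ring

lemma real_x (a c e t k n a' b' c' X Y Z KD : ℝ) (hKD : 0 < KD) (ht0 : 0 < t) (ht1 : t < 1) (hk : k = 1 - t)
    (ha1 : a ≤ 1) (hc1 : c ≤ 1) (hc0 : 0 ≤ c) (ha0 : 0 ≤ a) (he : 0 ≤ e) (hac : 16 * e ≤ t * (a * c)) (hn : 0 < n)
    (hsum : a' + b' + c' = n) (h1 : a' ≤ (a + e) * n) (h2 : a' + b' ≤ (1 - c + e) * n)
    (hX : X ≤ KD * (k * a')) (hY : KD * (k * b') ≤ Y) (hZ : KD * c' ≤ Z) (hpos : 0 < X + Y + Z) :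
    X / (X + Y + Z) ≤ a - 15 * e := by
  have hac' : 16 * e ≤ a := by nlinarith [mul_nonneg ha0 hc0, mul_le_mul_of_nonneg_left hc1 ha0]
  set g := a - 15 * e with hg
  have hg0 : 0 ≤ g := by linarith
  have hg1 : g ≤ 1 := by linarith
  rw [div_le_iff₀ hpos]
  have key : k * (a + e) ≤ g * (k + t * (c - e)) := by
    subst hk; rw [hg]
    have : 0 ≤ e * (t * (1 - a) + 15 * t * (1 - c + e)) := by
      apply mul_nonneg he
      have : 0 ≤ t * (1 - a) := mul_nonneg ht0.le (by linarith)
      have : 0 ≤ t * (1 - c + e) := mul_nonneg ht0.le (by linarith)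
      linarith
    nlinarith
  have hk0 : 0 ≤ k := by linarith
  have key2 : k * a' ≤ g * (k * a' + k * b' + c') := by
    have l1 : k * a' ≤ k * ((a + e) * n) := by gcongr
    have l2 : k * (a + e) * n ≤ g * (k + t * (c - e)) * n := by gcongr
    have l3 : n * (k + t * (c - e)) ≤ k * a' + k * b' + c' := by
      have := mul_le_mul_of_nonneg_left h2 ht0.le
      subst hk; nlinarith
    have l4 := mul_le_mul_of_nonneg_left l3 hg0
    nlinarith
  have key3 := mul_le_mul_of_nonneg_left key2 hKD.le
  have m1 := mul_le_mul_of_nonneg_left hX (by linarith : 0 ≤ 1 - g)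
  have m2 := mul_le_mul_of_nonneg_left hY hg0
  have m3 := mul_le_mul_of_nonneg_left hZ hg0
  nlinarith

lemma real_z (a b c e t k n a' b' c' X Y Z KD : ℝ) (hKD : 0 < KD) (ht0 : 0 < t) (ht1 : t < 1) (hk : k = 1 - t)
    (habc : a + b + c = 1) (hb0 : 0 ≤ b)
    (hc0 : 0 ≤ c) (ha0 : 0 ≤ a) (he : 0 ≤ e) (hac : 16 * e ≤ t * (a * c)) (hn : 0 < n)
    (hsum : a' + b' + c' = n) (h1 : b' ≤ (b + e) * n) (h2 : a' + b' ≤ (1 - c + e) * n)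
    (hX : X ≤ KD * (k * a')) (hY : Y ≤ KD * b') (hZ : KD * c' ≤ Z) (hpos : 0 < X + Y + Z) :
    c + 15 * e ≤ Z / (X + Y + Z) := by
  have hc1 : c ≤ 1 := by linarith
  have hac' : 16 * e ≤ a := by nlinarith [mul_nonneg ha0 hc0, mul_le_mul_of_nonneg_left hc1 ha0]
  set g := c + 15 * e with hg
  have hg0 : 0 ≤ g := by linarith
  have hg1 : g ≤ 1 := by linarith
  rw [le_div_iff₀ hpos]
  have key : g * (1 - t * a) ≤ c - e := by
    rw [hg]
    have : 0 ≤ e * (t * a) := by positivity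
    nlinarith
  have hk0 : 0 ≤ k := by linarith
  have l1 : k * a' + b' ≤ (1 - c - t * a + e) * n := by
    have := mul_le_mul_of_nonneg_left h2 hk0
    have := mul_le_mul_of_nonneg_left h1 ht0.le
    have hb : b = 1 - a - c := by linarith
    subst hk hb; nlinarith
  have l2 : (c - e) * n ≤ c' := by nlinarith
  have key2 : g * (k * a' + b') ≤ (1 - g) * c' := by
    have m1 := mul_le_mul_of_nonneg_left l1 hg0
    have m2 := mul_le_mul_of_nonneg_left l2 (by linarith : 0 ≤ 1 - g)
    have m3 := mul_le_mul_of_nonneg_right key hn.le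
    nlinarith
  have key3 := mul_le_mul_of_nonneg_left key2 hKD.le
  have m1 := mul_le_mul_of_nonneg_left hX hg0
  have m2 := mul_le_mul_of_nonneg_left hY hg0
  have m3 := mul_le_mul_of_nonneg_left hZ (by linarith : 0 ≤ 1 - g)
  nlinarith

open scoped ComplexOrder in
lemma gr_lemma {L w : ℕ} (T W : Matrix (Fin L) (Fin L) ℂ) (hW : IsProjOfRank w W)
    (hT : ∀ x, T *ᵥ x = 0 → x = 0) (v : Fin L → ℂ) :
    ∃ w1, W *ᵥ w1 = w1 ∧ ((1 - grAct T W) * T) *ᵥ v = T *ᵥ (v - w1) ∧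
      ∀ y, W *ᵥ y = y → star (T *ᵥ y) ⬝ᵥ (T *ᵥ (v - w1)) = 0 := by
  obtain ⟨h1, h2, -⟩ := hW
  set K := W * Tᴴ * T * W + (1 - W) with hK
  have hWK : W * K = W * Tᴴ * T * W := by
    rw [hK, mul_add, mul_sub, h1]; simp [← mul_assoc, h1]
  have hdet : IsUnit K.det := by
    rw [isUnit_iff_ne_zero]
    intro h0
    obtain ⟨s, hs0, hs⟩ := Matrix.exists_mulVec_eq_zero_iff.2 h0
    apply hs0
    have e1 : (W * Tᴴ * T * W) *ᵥ s = 0 := by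
      rw [← hWK, ← Matrix.mulVec_mulVec, hs, Matrix.mulVec_zero]
    have e2 : T *ᵥ (W *ᵥ s) = 0 := by
      have : ((T * W)ᴴ * (T * W)) *ᵥ s = 0 := by
        rw [Matrix.conjTranspose_mul, h2]; simpa [mul_assoc] using e1
      rw [Matrix.conjTranspose_mul_self_mulVec_eq_zero] at this
      simpa using this
    have e3 := hT _ e2
    have e4 : (1 - W) *ᵥ s = 0 := by
      rw [hK, Matrix.add_mulVec, e1, zero_add] at hs; exact hs
    rw [Matrix.sub_mulVec, e3] at e4
    simpa using e4
  have hKi : K * K⁻¹ = 1 := Matrix.mul_nonsing_inv _ hdet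
  have hmain : W * Tᴴ * T * W * K⁻¹ = W := by rw [← hWK, mul_assoc, hKi, mul_one]
  refine ⟨(W * K⁻¹ * W * Tᴴ * T) *ᵥ v, ?_, ?_, ?_⟩
  · rw [Matrix.mulVec_mulVec]; simp [← mul_assoc, h1]
  · rw [Matrix.mulVec_sub, Matrix.mulVec_mulVec, sub_mul, Matrix.sub_mulVec, one_mul]
    rw [grAct, ← hK]
    simp only [mul_assoc]
  · intro y hy
    have : star (T *ᵥ y) = star y ᵥ* (W * Tᴴ) := by
      rw [← hy, Matrix.mulVec_mulVec, Matrix.star_mulVec, Matrix.conjTranspose_mul, h2, hy]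
    rw [this, ← Matrix.dotProduct_mulVec]
    have z : (W * Tᴴ) *ᵥ (T *ᵥ (v - (W * K⁻¹ * W * Tᴴ * T) *ᵥ v)) = 0 := by
      rw [Matrix.mulVec_sub, Matrix.mulVec_sub]
      simp only [Matrix.mulVec_mulVec]
      rw [sub_eq_zero]
      congr 1
      calc W * Tᴴ * T = W * W * Tᴴ * T := by rw [h1]
        _ = W * Tᴴ * T * W * K⁻¹ * W * Tᴴ * T := by rw [hmain]
        _ = _ := by simp only [mul_assoc]
    rw [z]; simp


def pS {L : ℕ} (p : Fin L → Prop) [DecidablePred p] (v : Fin L → ℂ) : ℝ :=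
  ∑ i, if p i then ‖v i‖ ^ 2 else 0

def pMask {L : ℕ} (p : Fin L → Prop) [DecidablePred p] (v : Fin L → ℂ) : EuclideanSpace ℂ (Fin L) :=
  WithLp.toLp 2 (fun i => if p i then v i else 0)

lemma norm_pMask {L : ℕ} (p : Fin L → Prop) [DecidablePred p] (v : Fin L → ℂ) :
    ‖pMask p v‖ ^ 2 = pS p v := by
  rw [EuclideanSpace.norm_sq_eq]
  simp only [pMask, pS]
  refine Finset.sum_congr rfl fun i _ => ?_
  split_ifs <;> simp

lemma pS_nonneg {L : ℕ} (p : Fin L → Prop) [DecidablePred p] (v : Fin L → ℂ) : 0 ≤ pS p v := by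
  unfold pS
  refine Finset.sum_nonneg fun i _ => ?_
  split_ifs <;> positivity

lemma pS_add_not {L : ℕ} (p : Fin L → Prop) [DecidablePred p] (v : Fin L → ℂ) :
    pS p v + pS (fun i => ¬ p i) v = sqNorm v := by
  unfold pS sqNorm
  rw [← Finset.sum_add_distrib]
  refine Finset.sum_congr rfl fun i _ => ?_
  by_cases h : p i <;> simp [h]

lemma mask_planar {L : ℕ} (p : Fin L → Prop) [DecidablePred p] (u u0 : Fin L → ℂ) (c : ℝ)
    (hc : 0 ≤ c) (hu : 0 < sqNorm u) (hu0 : 0 < sqNorm u0)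
    (h : sqNorm (u - u0) ≤ c ^ 2 * sqNorm u) :
    |pS p u / sqNorm u - pS p u0 / sqNorm u0| ≤ c := by
  rw [← pS_add_not p u] at *
  rw [← pS_add_not p u0] at *
  rw [← pS_add_not p (u - u0)] at h
  simp only [← norm_pMask] at *
  apply planar _ _ _ _ _ hc hu hu0
  refine le_trans ?_ h
  have key : ∀ (q : Fin L → Prop) [DecidablePred q],
      (‖pMask q u‖ - ‖pMask q u0‖) ^ 2 ≤ ‖pMask q (u - u0)‖ ^ 2 := by
    intro q _
    have : pMask q (u - u0) = pMask q u - pMask q u0 := by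
      ext i; simp only [pMask, PiLp.sub_apply, Pi.sub_apply]; split_ifs <;> simp
    rw [this]
    exact sq_le_sq' (by have := norm_sub_norm_le (pMask q u0) (pMask q u); rw [norm_sub_rev] at this; linarith)
      (norm_sub_norm_le _ _)
  exact add_le_add (key p) (key _)

lemma circ_pS {L : ℕ} (p : Fin L → Prop) [DecidablePred p] (S : Matrix (Fin L) (Fin L) ℂ) (v : Fin L → ℂ) :
    pS p (circAct S v) = pS p (S *ᵥ v) / sqNorm (S *ᵥ v) := by
  unfold pS
  rw [Finset.sum_div]
  refine Finset.sum_congr rfl fun i _ => ?_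
  split_ifs
  · unfold circAct vNorm
    have : 0 ≤ sqNorm (S *ᵥ v) := by unfold sqNorm; positivity
    rw [Pi.smul_apply, norm_smul, norm_inv, Complex.norm_real, Real.norm_of_nonneg (Real.sqrt_nonneg _),
      mul_pow, inv_pow, Real.sq_sqrt this]
    ring
  · simp

lemma proj_entry_s12 {L w : ℕ} (W : Matrix (Fin L) (Fin L) ℂ) (hW : IsProjOfRank w W)
    (y : Fin L → ℂ) (hy : W *ᵥ y = y) (i : Fin L) :
    0 ≤ (W i i).re ∧ ‖y i‖ ^ 2 ≤ (W i i).re * sqNorm y := by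
  obtain ⟨h1, h2, -⟩ := hW
  have hr : (W i i).re = ∑ j, ‖W i j‖ ^ 2 := by
    have : W i i = ∑ j, ((‖W i j‖ ^ 2 : ℝ) : ℂ) := by
      conv_lhs => rw [← h1, Matrix.mul_apply]
      refine Finset.sum_congr rfl fun j _ => ?_
      have : W j i = star (W i j) := by
        conv_lhs => rw [← h2]
        rfl
      rw [this, Complex.star_def, Complex.mul_conj, Complex.normSq_eq_norm_sq]
    rw [this, ← Complex.ofReal_sum, Complex.ofReal_re]
  refine ⟨by rw [hr]; positivity, ?_⟩
  have e : y i = ∑ j, W i j * y j := by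
    conv_lhs => rw [← hy]
    rfl
  rw [hr, sqNorm]
  have : ‖y i‖ ≤ ∑ j, ‖W i j‖ * ‖y j‖ := by
    rw [e]; refine (norm_sum_le _ _).trans (le_of_eq ?_); simp
  exact (pow_le_pow_left₀ (norm_nonneg _) this 2).trans (Finset.sum_mul_sq_le_sq_mul_sq _ _ _)

lemma pS_sub_le {L w : ℕ} (W : Matrix (Fin L) (Fin L) ℂ) (hW : IsProjOfRank w W)
    (p q : Fin L → Prop) [DecidablePred p] [DecidablePred q] (hpq : ∀ i, p i → q i) (e : ℝ)
    (he : (∑ i, if q i then (W i i).re else 0) ≤ e)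
    (y : Fin L → ℂ) (hy : W *ᵥ y = y) (v : Fin L → ℂ) :
    pS p (v - y) ≤ (pS p v + e) * (1 + sqNorm y) := by
  have hs : 0 ≤ sqNorm y := by unfold sqNorm; positivity
  have h1 : pS p (v - y) ≤ (pS p v + ∑ i, if q i then (W i i).re else 0) * (1 + sqNorm y) := by
    unfold pS
    rw [← Finset.sum_add_distrib, Finset.sum_mul]
    refine Finset.sum_le_sum fun i _ => ?_
    obtain ⟨hr, hb⟩ := proj_entry_s12 W hW y hy i
    by_cases hp : p i
    · simp only [hp, hpq i hp, if_true, Pi.sub_apply]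
      set r := (W i i).re
      set s := sqNorm y
      have e1 : ‖v i - y i‖ ^ 2 ≤ (‖v i‖ + ‖y i‖) ^ 2 :=
        pow_le_pow_left₀ (norm_nonneg _) (norm_sub_le _ _) 2
      have e2 : ‖y i‖ ≤ Real.sqrt r * Real.sqrt s := by
        rw [← Real.sqrt_mul hr]; exact Real.le_sqrt_of_sq_le hb
      have e3 : ‖v i‖ * ‖y i‖ ≤ ‖v i‖ * (Real.sqrt r * Real.sqrt s) := by gcongr
      have e4 := Real.sq_sqrt hr
      have e5 := Real.sq_sqrt hs
      nlinarith [sq_nonneg (‖v i‖ * Real.sqrt s - Real.sqrt r)]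
    · simp only [hp, if_false]
      split_ifs <;> positivity
  exact h1.trans (by gcongr)

lemma hover_eq (L r : ℕ) (W : Matrix (Fin L) (Fin L) ℂ) (hr : r ≤ L) :
    ((basisFrame L r 0)ᴴ * W * basisFrame L r 0).trace.re =
      ∑ i : Fin L, if (i : ℕ) < r then (W i i).re else 0 := by
  have hF : basisFrame L r 0 * (basisFrame L r 0)ᴴ =
      Matrix.diagonal (fun i : Fin L => if (i : ℕ) < r then (1 : ℂ) else 0) := by
    ext i k
    rw [Matrix.mul_apply, Matrix.diagonal_apply]
    simp only [basisFrame, Matrix.of_apply, Matrix.conjTranspose_apply, zero_add]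
    by_cases hi : (i : ℕ) < r
    · rw [Finset.sum_eq_single (⟨i, hi⟩ : Fin r)]
      · by_cases hik : i = k
        · subst hik; simp [hi]
        · have : (k : ℕ) ≠ i := fun h => hik (Fin.ext h.symm)
          simp [hik, this]
      · intro j _ hj
        have : (i : ℕ) ≠ j := fun h => hj (Fin.ext h.symm)
        simp [this]
      · simp
    · rw [Finset.sum_eq_zero]
      · simp [hi]
      · intro j _
        have : (i : ℕ) ≠ j := by have := j.2; omega
        simp [this]
  rw [Matrix.mul_assoc, Matrix.trace_mul_comm, Matrix.mul_assoc, hF, Matrix.trace, Complex.re_sum]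
  refine Finset.sum_congr rfl fun i _ => ?_
  rw [Matrix.diag_apply, Matrix.mul_diagonal]
  split_ifs <;> simp

lemma sqNorm_sub_orth {L w : ℕ} (W : Matrix (Fin L) (Fin L) ℂ) (hW : IsProjOfRank w W)
    (v y : Fin L → ℂ) (hv : W *ᵥ v = 0) (hy : W *ᵥ y = y) :
    sqNorm (v - y) = sqNorm v + sqNorm y := by
  obtain ⟨-, h2, -⟩ := hW
  have h : star y ⬝ᵥ v = 0 := by
    rw [← hy, Matrix.star_mulVec, h2, ← Matrix.dotProduct_mulVec, hv, dotProduct_zero]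
  simp only [sqNorm_eq, WithLp.toLp_sub]
  have h' : inner ℂ (WithLp.toLp 2 y : EuclideanSpace ℂ (Fin L)) (WithLp.toLp 2 v) = 0 := by
    rw [EuclideanSpace.inner_toLp_toLp, dotProduct_comm]; exact h
  have h'' : inner ℂ (WithLp.toLp 2 v : EuclideanSpace ℂ (Fin L)) (WithLp.toLp 2 y) = 0 := by
    rw [← inner_conj_symm, h']; simp
  rw [@norm_sub_sq ℂ, h'']; simp

lemma step1 (L D E w : ℕ) (hD : 1 ≤ D) (hDE : D < E) (hE : E ≤ L)
    (lam : ℝ) (hlam0 : 0 < lam) (κ : ℕ → ℝ)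
    (hκpos : ∀ i, 1 ≤ i → i ≤ L → 0 < κ i)
    (hκmono : ∀ i j, 1 ≤ i → i ≤ j → j ≤ L → κ j ≤ κ i)
    (hτpos : 0 < eta κ D E)
    (W : Matrix (Fin L) (Fin L) ℂ) (hW : IsProjOfRank w W)
    (v : Fin L → ℂ) (hv : sqNorm v = 1) (hWv : W.mulVec v = 0)
    (hover : ((basisFrame L (L - D) 0)ᴴ * W * basisFrame L (L - D) 0).trace.re
      ≤ 2⁻¹ ^ 3 * lam)
    (hladder : 2 * lam / eta κ D E ≤ xSq E v * zSq D v)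
    (y : Fin L → ℂ) (hy : W *ᵥ y = y) (u : Fin L → ℂ) (hu : u = Rmat κ L *ᵥ (v - y))
    (hupos : 0 < sqNorm u) :
    xSq E u / sqNorm u ≤ xSq E v - 15 / 8 * lam ∧
    zSq D v + 15 / 8 * lam ≤ zSq D u / sqNorm u := by
  have hnn : ∀ i : Fin L, ‖u i‖ ^ 2 = κ (L - i) ^ 2 * ‖(v - y) i‖ ^ 2 := by
    intro i
    rw [hu, Rmat, Matrix.mulVec_diagonal, norm_mul, mul_pow, Complex.norm_real, Real.norm_eq_abs, sq_abs]
  have hκD := hκpos D hD (by omega)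
  have hκE := hκpos E (by omega) hE
  rw [hover_eq L (L - D) W (by omega)] at hover
  set e := lam / 8 with he
  have hover' : (∑ i : Fin L, if (i : ℕ) < L - D then (W i i).re else 0) ≤ e := by
    rw [he]; norm_num at hover; linarith
  let pX : Fin L → Prop := fun i => (i : ℕ) < L - E
  let pY : Fin L → Prop := fun i => L - E ≤ (i : ℕ) ∧ (i : ℕ) < L - D
  let pQ : Fin L → Prop := fun i => (i : ℕ) < L - D
  have hsplit : ∀ x : Fin L → ℂ, xSq E x + pS pY x + zSq D x = sqNorm x := by
    intro x
    unfold xSq pS zSq sqNorm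
    rw [← Finset.sum_add_distrib, ← Finset.sum_add_distrib]
    refine Finset.sum_congr rfl fun i _ => ?_
    by_cases h1 : (i : ℕ) < L - E
    · have h2 : ¬ (L - D ≤ (i : ℕ)) := by omega
      have h3 : ¬ pY i := by simp only [pY]; omega
      simp [h1, h2, h3]
    · by_cases h2 : L - D ≤ (i : ℕ)
      · have h3 : ¬ pY i := by simp only [pY]; omega
        simp [h1, h2, h3]
      · have h3 : pY i := by simp only [pY]; omega
        simp [h1, h2, h3]
  have hsplit2 : ∀ x : Fin L → ℂ, xSq E x + pS pY x = pS pQ x := by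
    intro x
    unfold xSq pS
    rw [← Finset.sum_add_distrib]
    refine Finset.sum_congr rfl fun i _ => ?_
    by_cases h1 : (i : ℕ) < L - E
    · have h2 : pQ i := by simp only [pQ]; omega
      have h3 : ¬ pY i := by simp only [pY]; omega
      simp [h1, h2, h3]
    · by_cases h2 : L - D ≤ (i : ℕ)
      · have h3 : ¬ pY i := by simp only [pY]; omega
        have h4 : ¬ pQ i := by simp only [pQ]; omega
        simp [h1, h4, h3]
      · have h3 : pY i := by simp only [pY]; omega
        have h4 : pQ i := by simp only [pQ]; omega
        simp [h1, h4, h3]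
  have hs : 0 ≤ sqNorm y := by unfold sqNorm; positivity
  have horth := sqNorm_sub_orth W hW v y hWv hy
  rw [hv] at horth
  have bX : xSq E (v - y) ≤ (xSq E v + e) * (1 + sqNorm y) :=
    pS_sub_le W hW pX pQ (fun i h => by simp only [pX, pQ] at *; omega) e hover' y hy v
  have bY : pS pY (v - y) ≤ (pS pY v + e) * (1 + sqNorm y) :=
    pS_sub_le W hW pY pQ (fun i h => by simp only [pY, pQ] at *; omega) e hover' y hy v
  have bQ : pS pQ (v - y) ≤ (pS pQ v + e) * (1 + sqNorm y) :=
    pS_sub_le W hW pQ pQ (fun i h => h) e hover' y hy v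
  have hx0 : 0 ≤ xSq E v := pS_nonneg pX v
  have hy0 : 0 ≤ pS pY v := pS_nonneg pY v
  have hz0 : 0 ≤ zSq D v := pS_nonneg (fun i : Fin L => L - D ≤ (i : ℕ)) v
  have hsv := hsplit v
  rw [hv] at hsv
  have hQv : pS pQ v = 1 - zSq D v := by rw [← hsplit2]; linarith
  rw [← hsplit2, hQv] at bQ
  have hsum := hsplit (v - y)
  rw [horth] at hsum
  set t := eta κ D E with ht
  set k := κ E ^ 2 / κ D ^ 2 with hk
  have hkt : k = 1 - t := by rw [ht, eta]; ring
  have hk0 : 0 < k := by positivity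
  have hKk : κ D ^ 2 * k = κ E ^ 2 := by rw [hk]; field_simp
  have hladder' : 16 * e ≤ t * (xSq E v * zSq D v) := by
    rw [div_le_iff₀ hτpos] at hladder; rw [he]; linarith
  -- bounds on components
  have kX : xSq E u ≤ κ D ^ 2 * (k * xSq E (v - y)) := by
    rw [← mul_assoc, hKk]
    unfold xSq
    rw [Finset.mul_sum]
    refine Finset.sum_le_sum fun i _ => ?_
    split_ifs with h
    · rw [hnn]
      have h1 := hκmono E (L - i) (by omega) (by omega) (by omega)
      have h2 := hκpos (L - i) (by omega) (by omega)
      gcongr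
    · simp
  have kZ : κ D ^ 2 * zSq D (v - y) ≤ zSq D u := by
    unfold zSq
    rw [Finset.mul_sum]
    refine Finset.sum_le_sum fun i _ => ?_
    split_ifs with h
    · rw [hnn]
      have h1 := hκmono (L - i) D (by omega) (by omega) (by omega)
      gcongr
    · simp
  have kY1 : κ D ^ 2 * (k * pS pY (v - y)) ≤ pS pY u := by
    rw [← mul_assoc, hKk]
    unfold pS
    rw [Finset.mul_sum]
    refine Finset.sum_le_sum fun i _ => ?_
    split_ifs with h
    · rw [hnn]
      simp only [pY] at h
      have h1 := hκmono (L - i) E (by omega) (by omega) (by omega)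
      gcongr
    · simp
  have kY2 : pS pY u ≤ κ D ^ 2 * pS pY (v - y) := by
    unfold pS
    rw [Finset.mul_sum]
    refine Finset.sum_le_sum fun i _ => ?_
    split_ifs with h
    · rw [hnn]
      simp only [pY] at h
      have h1 := hκmono D (L - i) (by omega) (by omega) (by omega)
      have h2 := hκpos (L - i) (by omega) (by omega)
      gcongr
    · simp
  have hup := hsplit u
  have hpos : 0 < xSq E u + pS pY u + zSq D u := by rw [hup]; exact hupos
  have he0 : 0 ≤ e := by rw [he]; positivity
  have hKD : 0 < κ D ^ 2 := by positivity
  rw [← hup]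
  constructor
  · have := real_x (xSq E v) (zSq D v) e t k (1 + sqNorm y) _ _ _ _ _ _ (κ D ^ 2) hKD hτpos
      (by linarith) hkt (by linarith) (by linarith) hz0 hx0 he0 hladder' (by linarith) hsum bX bQ
      kX kY1 kZ hpos
    rw [he] at this
    linarith
  · have := real_z (xSq E v) (pS pY v) (zSq D v) e t k (1 + sqNorm y) _ _ _ _ _ _ (κ D ^ 2) hKD hτpos
      (by linarith) hkt hsv hy0 hz0 hx0 he0 hladder' (by linarith) hsum bY bQ
      kX kY2 kZ hpos
    rw [he] at this
    linarith

/-- strict decrease/increase of the upper/lower part for the full random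
action, in the overwhelming region: if `tr[(ζ̂^⊥)*Wζ̂^⊥] ≤ 2^{-3}λ` and
`‖𝔵(v)‖²‖𝔷(v)‖² ≥ 2λ/τ` with `τ = η(D,E) > 0`, then
`‖𝔵((((e^{λP}ℛ)·W)^⊥(e^{λP}ℛ))∘v)‖² ≤ ‖𝔵(v)‖² − 2^{-2}λ` and
`‖𝔷((((e^{λP}ℛ)·W)^⊥(e^{λP}ℛ))∘v)‖² ≥ ‖𝔷(v)‖² + 2^{-2}λ`. -/
theorem statement12 (L D E w : ℕ) (hD : 1 ≤ D) (hDE : D < E) (hE : E ≤ L)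
    (lam : ℝ) (hlam0 : 0 < lam) (hlam : lam ≤ 1 / 2 ^ 6)
    (κ : ℕ → ℝ)
    (hκpos : ∀ i, 1 ≤ i → i ≤ L → 0 < κ i)
    (hκmono : ∀ i j, 1 ≤ i → i ≤ j → j ≤ L → κ j ≤ κ i)
    (hτpos : 0 < eta κ D E)
    (P : Matrix (Fin L) (Fin L) ℂ) (hP : opNorm P ≤ 1)
    (W : Matrix (Fin L) (Fin L) ℂ) (hW : IsProjOfRank w W)
    (v : Fin L → ℂ) (hv : sqNorm v = 1) (hWv : W.mulVec v = 0)
    (hover : ((basisFrame L (L - D) 0)ᴴ * W * basisFrame L (L - D) 0).trace.re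
      ≤ 2⁻¹ ^ 3 * lam)
    (hladder : 2 * lam / eta κ D E ≤ xSq E v * zSq D v) :
    xSq E (circAct ((1 - grAct (mexp ((lam : ℂ) • P) * Rmat κ L) W)
        * (mexp ((lam : ℂ) • P) * Rmat κ L)) v) ≤ xSq E v - 2⁻¹ ^ 2 * lam ∧
    zSq D (circAct ((1 - grAct (mexp ((lam : ℂ) • P) * Rmat κ L) W)
        * (mexp ((lam : ℂ) • P) * Rmat κ L)) v) ≥ zSq D v + 2⁻¹ ^ 2 * lam := by
  set M := mexp ((lam : ℂ) • P) with hM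
  set R := Rmat κ L with hR
  have hl : lam ≤ 1 / 64 := by norm_num at hlam ⊢; exact hlam
  have hN : ∀ x : Fin L → ℂ, ‖WithLp.toLp 2 ((M - 1) *ᵥ x)‖ ≤ 65 / 64 * lam * ‖WithLp.toLp 2 x‖ :=
    mexp_bound P hP lam hlam0 hlam
  set p := 65 / 64 * lam with hp
  have hp0 : 0 ≤ p := by rw [hp]; positivity
  have hp1 : p ≤ 1 / 60 := by rw [hp]; linarith
  have hRinj : ∀ x, R *ᵥ x = 0 → x = 0 := by
    intro x hx
    ext i
    have := congrFun hx i
    rw [hR, Rmat, Matrix.mulVec_diagonal] at this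
    have hk := hκpos (L - i) (by omega) (by omega)
    rcases mul_eq_zero.1 this with h | h
    · exact absurd (Complex.ofReal_eq_zero.1 h) hk.ne'
    · exact h
  have hMlow : ∀ x : Fin L → ℂ, (1 - p) * ‖(WithLp.toLp 2 x : EuclideanSpace ℂ (Fin L))‖ ≤
      ‖(WithLp.toLp 2 (M *ᵥ x) : EuclideanSpace ℂ (Fin L))‖ := by
    intro x
    have e : (WithLp.toLp 2 x : EuclideanSpace ℂ (Fin L)) =
        WithLp.toLp 2 (M *ᵥ x) - WithLp.toLp 2 ((M - 1) *ᵥ x) := by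
      rw [← WithLp.toLp_sub, Matrix.sub_mulVec, Matrix.one_mulVec]; simp
    have h1 := norm_sub_le (WithLp.toLp 2 (M *ᵥ x) : EuclideanSpace ℂ (Fin L))
      (WithLp.toLp 2 ((M - 1) *ᵥ x))
    rw [← e] at h1
    have := hN x
    linarith
  have hzero : ∀ x : Fin L → ℂ, x ≠ 0 → 0 < ‖(WithLp.toLp 2 x : EuclideanSpace ℂ (Fin L))‖ := by
    intro x hx
    rw [norm_pos_iff]
    intro h; apply hx
    simpa using h
  have hTinj : ∀ x, (M * R) *ᵥ x = 0 → x = 0 := by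
    intro x hx
    rw [← Matrix.mulVec_mulVec] at hx
    by_contra hne
    have h1 := hMlow (R *ᵥ x)
    have h2 := hzero (R *ᵥ x) (fun h => hne (hRinj x h))
    rw [hx, WithLp.toLp_zero, norm_zero] at h1
    nlinarith
  obtain ⟨w1, hw1, hu, ho⟩ := gr_lemma (M * R) W hW hTinj v
  obtain ⟨w0, hw0, -, ho0⟩ := gr_lemma R W hW hRinj v
  set u0 := R *ᵥ (v - w0) with hu0
  set u := (M * R) *ᵥ (v - w1) with hudef
  have hne : ∀ y, W *ᵥ y = y → v - y ≠ 0 := by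
    intro y hy h
    have := sqNorm_sub_orth W hW v y hWv hy
    rw [h, hv] at this
    have h0 : sqNorm (0 : Fin L → ℂ) = 0 := by simp [sqNorm]
    have hs : 0 ≤ sqNorm y := by unfold sqNorm; positivity
    linarith
  have hupos : 0 < sqNorm u := by
    rw [sqNorm_eq]
    exact pow_pos (hzero _ fun h => hne w1 hw1 (hTinj _ h)) 2
  have hu0pos : 0 < sqNorm u0 := by
    rw [sqNorm_eq]
    exact pow_pos (hzero _ fun h => hne w0 hw0 (hRinj _ h)) 2
  have hWW := hW.1
  -- perturbation step
  have hq : u0 - R *ᵥ (w1 - w0) = R *ᵥ (v - w1) := by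
    rw [hu0, ← Matrix.mulVec_sub]; congr 1; abel
  have hdiff : sqNorm (u - u0) ≤ (13 / 8 * lam) ^ 2 * sqNorm u := by
    have key := hilb_aux (V := EuclideanSpace ℂ (Fin L))
      (LinearMap.range (Matrix.toEuclideanLin (R * W)))
      (fun x => WithLp.toLp 2 ((M - 1) *ᵥ x.ofLp)) p hp0 (fun x => hN x.ofLp)
      (WithLp.toLp 2 u0) (WithLp.toLp 2 (R *ᵥ (w1 - w0))) (WithLp.toLp 2 u)
      (by
        rw [Submodule.mem_orthogonal]
        rintro _ ⟨z, rfl⟩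
        have h1 := ho0 (W *ᵥ z.ofLp) (by rw [Matrix.mulVec_mulVec, hWW])
        rw [Matrix.mulVec_mulVec] at h1
        rw [Matrix.toEuclideanLin_apply, EuclideanSpace.inner_toLp_toLp, dotProduct_comm]
        exact h1)
      (by
        refine ⟨WithLp.toLp 2 (w1 - w0), ?_⟩
        rw [Matrix.toEuclideanLin_apply]
        congr 1
        rw [← Matrix.mulVec_mulVec]
        congr 1
        rw [Matrix.mulVec_sub, hw1, hw0])
      (by
        rw [← WithLp.toLp_sub, hq, ← WithLp.toLp_add]
        congr 1
        rw [Matrix.sub_mulVec, Matrix.one_mulVec, hudef, ← Matrix.mulVec_mulVec]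
        simp)
      (by
        rintro _ ⟨z, rfl⟩
        have h1 := ho (W *ᵥ z.ofLp) (by rw [Matrix.mulVec_mulVec, hWW])
        rw [Matrix.toEuclideanLin_apply, ← WithLp.toLp_add, EuclideanSpace.inner_toLp_toLp,
          dotProduct_comm]
        have e1 : (R * W) *ᵥ z.ofLp + (M - 1) *ᵥ ((R * W) *ᵥ z.ofLp) =
            (M * R) *ᵥ (W *ᵥ z.ofLp) := by
          rw [Matrix.sub_mulVec, Matrix.one_mulVec]
          simp [Matrix.mulVec_mulVec, Matrix.mul_assoc]
        rw [← e1] at h1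
        exact h1)
    rw [← WithLp.toLp_sub, ← WithLp.toLp_sub, hq] at key
    have hlow := hMlow (R *ᵥ (v - w1))
    rw [Matrix.mulVec_mulVec, ← hudef] at hlow
    simp only [sqNorm_eq]
    set a := ‖(WithLp.toLp 2 u : EuclideanSpace ℂ (Fin L))‖
    set b := ‖(WithLp.toLp 2 (R *ᵥ (v - w1)) : EuclideanSpace ℂ (Fin L))‖
    have hb0 : 0 ≤ b := norm_nonneg _
    have ha0 : 0 ≤ a := norm_nonneg _
    have hb : b ≤ 60 / 59 * a := by nlinarith
    have hb2 : b ^ 2 ≤ (60 / 59 * a) ^ 2 := pow_le_pow_left₀ hb0 hb 2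
    refine key.trans ?_
    have : p ^ 2 * b ^ 2 ≤ p ^ 2 * (60 / 59 * a) ^ 2 := by gcongr
    have h3 : 0 ≤ lam ^ 2 * a ^ 2 := by positivity
    rw [hp] at this ⊢
    nlinarith
  obtain ⟨sx, sz⟩ := step1 L D E w hD hDE hE lam hlam0 κ hκpos hκmono hτpos W hW v hv hWv hover
    hladder w0 hw0 u0 hu0 hu0pos
  have cx := mask_planar (fun i : Fin L => (i : ℕ) < L - E) u u0 (13 / 8 * lam) (by positivity)
    hupos hu0pos hdiff
  have cz := mask_planar (fun i : Fin L => L - D ≤ (i : ℕ)) u u0 (13 / 8 * lam) (by positivity)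
    hupos hu0pos hdiff
  have ex := circ_pS (fun i : Fin L => (i : ℕ) < L - E) ((1 - grAct (M * R) W) * (M * R)) v
  have ez := circ_pS (fun i : Fin L => L - D ≤ (i : ℕ)) ((1 - grAct (M * R) W) * (M * R)) v
  rw [hu] at ex ez
  change xSq E _ = xSq E _ / _ at ex
  change zSq D _ = zSq D _ / _ at ez
  change |xSq E _ / _ - xSq E _ / _| ≤ _ at cx
  change |zSq D _ / _ - zSq D _ / _| ≤ _ at cz
  rw [abs_le] at cx cz
  rw [ex, ez]
  constructor
  · norm_num; linarith [cx.2]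
  · norm_num; linarith [cz.1]

end
end
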